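/- arXiv:1901.05065 — 9 statements merged into one kernel-verified Lean document; each statement's English description precedes it below -/
import Mathlib

section
/- Let X be a set and F a finite group acting freely on X. Let f ∈ Perm(X) be a permutation such that for every s ∈ F the commutator f ∘ s ∘ f⁻¹ ∘ s⁻¹ (where s also denotes the permutation x ↦ s·x) is finitely supported. Then there exists a permutation g of X such that {x : g(x) ≠ f(x)} is finite and g(s·x) = s·g(x) for all s ∈ F and all x ∈ X. -/
universe u v

/-- Translating representatives of the orbits of a free action parametrizes the whole space. -/
theorem bijective_smul_out_of_free {G : Type*} {A : Type*} [Group G] [MulAction G A]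
    (hA : ∀ (s : G) (a : A), s • a = a → s = 1) :
    Function.Bijective
      (fun p : G × MulAction.orbitRel.Quotient G A => p.1 • (Quotient.out p.2 : A)) := by
  constructor
  · rintro ⟨s, o⟩ ⟨t, o'⟩ h
    replace h : s • (Quotient.out o : A) = t • (Quotient.out o' : A) := h
    obtain rfl : o = o' := by
      rw [← Quotient.out_eq o, ← Quotient.out_eq o']
      refine Quotient.sound (MulAction.orbitRel_apply.2 ⟨s⁻¹ * t, ?_⟩)
      change (s⁻¹ * t) • (Quotient.out o' : A) = Quotient.out o
      rw [mul_smul, ← h, inv_smul_smul]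
    have hts : t⁻¹ * s = 1 := hA _ (Quotient.out o) (by rw [mul_smul, h, inv_smul_smul])
    rw [inv_mul_eq_one.1 hts]
  · intro a
    obtain ⟨s, hs⟩ := MulAction.orbitRel_apply.1
      ((MulAction.orbitRel G A).symm (Quotient.mk_out (s := MulAction.orbitRel G A) a))
    exact ⟨(s, Quotient.mk (MulAction.orbitRel G A) a), hs⟩

/-- Two finite free `G`-sets of the same cardinality are isomorphic, for `G` finite. -/
theorem exists_equivariant_equiv_of_free {G : Type*} {A B : Type*} [Group G] [Finite G]
    [MulAction G A] [MulAction G B] [Finite A] [Finite B]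
    (hA : ∀ (s : G) (a : A), s • a = a → s = 1)
    (hB : ∀ (s : G) (b : B), s • b = b → s = 1) (hcard : Nat.card A = Nat.card B) :
    ∃ e : A ≃ B, ∀ (s : G) (a : A), e (s • a) = s • e a := by
  let eA := Equiv.ofBijective _ (bijective_smul_out_of_free hA)
  let eB := Equiv.ofBijective _ (bijective_smul_out_of_free hB)
  rw [← Nat.card_congr eA, ← Nat.card_congr eB, Nat.card_prod, Nat.card_prod] at hcard
  have : Finite (MulAction.orbitRel.Quotient G A) := Quotient.finite _
  have : Finite (MulAction.orbitRel.Quotient G B) := Quotient.finite _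
  obtain ⟨σ⟩ := Finite.card_eq.1 (Nat.eq_of_mul_eq_mul_left Nat.card_pos hcard)
  refine ⟨eA.symm.trans (((Equiv.refl G).prodCongr σ).trans eB), fun s a => ?_⟩
  obtain ⟨⟨t, o⟩, rfl⟩ := eA.surjective a
  have hs : s • eA (t, o) = eA (s * t, o) := (mul_smul s t _).symm
  rw [hs]
  simp only [Equiv.trans_apply, Equiv.symm_apply_apply]
  exact mul_smul s t _

/-- The points at which a map between `G`-sets fails to be equivariant form an invariant set. -/
def nonEquivariantLocus (G : Type*) {A B : Type*} [Group G] [MulAction G A] [MulAction G B]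
    (f : A → B) : SubMulAction G A where
  carrier := {x | ∃ s : G, f (s • x) ≠ s • f x}
  smul_mem' t x hx := by
    by_contra hc
    simp only [Set.mem_ofPred_eq, not_exists, not_not] at hc
    obtain ⟨s, hs⟩ := hx
    have ht : f x = t⁻¹ • f (t • x) := by simpa using hc t⁻¹
    apply hs
    rw [ht, ← mul_smul, ← hc, ← mul_smul, inv_mul_cancel_right]

theorem map_smul_of_notMem_nonEquivariantLocus {G A B : Type*} [Group G] [MulAction G A]
    [MulAction G B] {f : A → B} {x : A} (hx : x ∉ nonEquivariantLocus G f) (s : G) :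
    f (s • x) = s • f x := by
  by_contra h
  exact hx ⟨s, h⟩

/-- The image under a bijection of its non-equivariance locus. -/
def nonEquivariantLocusImage (G : Type*) {A B : Type*} [Group G] [MulAction G A] [MulAction G B]
    (f : A ≃ B) : SubMulAction G B where
  carrier := {y | f.symm y ∈ nonEquivariantLocus G f}
  smul_mem' t y hy := by
    by_contra hc
    have h := map_smul_of_notMem_nonEquivariantLocus hc t⁻¹
    rw [Equiv.apply_symm_apply, inv_smul_smul, ← Equiv.eq_symm_apply] at h
    change f.symm (t • y) ∉ nonEquivariantLocus G f at hc
    rw [← SubMulAction.smul_mem_iff' _ t⁻¹, h] at hc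
    exact hc hy

/-- Let a finite group `F` act freely on `X`, and let `f` be a permutation of `X`
whose commutator with (the permutation given by) each `s ∈ F` is finitely supported.
Then `f` coincides outside a finite set with a permutation `g` commuting with the
`F`-action. -/
theorem near_commuting_perm_near_equals_commuting_perm
    {X : Type u} {F : Type v} [Group F] [Finite F] [MulAction F X]
    (hfree : ∀ (s : F) (x : X), s • x = x → s = 1)
    (f : Equiv.Perm X)
    (hcomm : ∀ s : F,
      {x : X | (f * MulAction.toPerm s * f⁻¹ * (MulAction.toPerm s)⁻¹ : Equiv.Perm X) x ≠ x}.Finite) :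
    ∃ g : Equiv.Perm X, {x : X | g x ≠ f x}.Finite ∧ ∀ (s : F) (x : X), g (s • x) = s • g x := by
  classical
  set D := nonEquivariantLocus F f
  set D' := nonEquivariantLocusImage F f
  have hDfin : (D : Set X).Finite := by
    refine (Set.finite_iUnion fun s : F =>
      (hcomm s).preimage (f := fun x => s • f x)
        ((MulAction.injective s).comp f.injective).injOn).subset ?_
    rintro x ⟨s, hs⟩
    exact Set.mem_iUnion.2 ⟨s, by simpa [MulAction.toPerm_symm_apply] using hs⟩
  have hmem : ∀ x, x ∈ D ↔ f x ∈ D' := fun x => by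
    change x ∈ D ↔ f.symm (f x) ∈ D
    rw [Equiv.symm_apply_apply]
  let φ : D ≃ D' := f.subtypeEquiv hmem
  have : Finite D := hDfin.to_subtype
  have : Finite D' := Finite.of_equiv _ φ
  obtain ⟨e, he⟩ := exists_equivariant_equiv_of_free (G := F) (A := D) (B := D')
    (fun s a h => hfree s a (congrArg Subtype.val h))
    (fun s b h => hfree s b (congrArg Subtype.val h)) (Nat.card_congr φ)
  let g : Equiv.Perm X := Equiv.subtypeCongr (p := (· ∈ D)) (q := (· ∈ D')) e
    (f.subtypeEquiv fun x => not_congr (hmem x))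
  have hgD : ∀ (x : X) (hx : x ∈ D), g x = e ⟨x, hx⟩ := fun x hx => by
    simp [g, Equiv.subtypeCongr, Equiv.sumCompl_symm_apply_of_pos hx]
  have hgE : ∀ x : X, x ∉ D → g x = f x := fun x hx => by
    simp [g, Equiv.subtypeCongr, Equiv.sumCompl_symm_apply_of_neg hx]
  refine ⟨g, hDfin.subset fun x hx => by_contra fun h => hx (hgE x h), fun s x => ?_⟩
  by_cases hx : x ∈ D
  · rw [hgD x hx, hgD _ (D.smul_mem s hx)]
    exact congrArg Subtype.val (he s ⟨x, hx⟩)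
  · rw [hgE x hx, hgE _ (mt (SubMulAction.smul_mem_iff' D s).1 hx)]
    exact map_smul_of_notMem_nonEquivariantLocus hx s
end

section
/- Let G be a finitely presented group, X a set, and α : G → S⋆(X) a near action. Then there exist a finite generating subset S of G, for each s ∈ S a representative σ_s of α(s), and a subset Y of X contained in dom(σ_s) ∩ ran(σ_s) for every s ∈ S, such that: (i) σ_s(Y) = Y for every s ∈ S; (ii) there is a group homomorphism β : G → Perm(Y) with β(s) = σ_s|_Y for every s ∈ S, and for every g ∈ G and every representative σ of α(g) one has β(g)(y) = σ(y) for all but finitely many y ∈ Y; (iii) all but finitely many connected components of the graph with vertex set X and edge set {{x, σ_s(x)} : s ∈ S, x ∈ dom(σ_s)} are contained in Y. (In words: every near action of a finitely presented group is the disjoint union of a realizable near action and a near action of finite type.) -/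
open Set

universe u v w

variable {X : Type u}

/-- A cofinite-partial bijection of `X`: a partial bijection whose source and target
are cofinite subsets of `X`. -/
def IsCofinBij (e : PartialEquiv X X) : Prop :=
  e.sourceᶜ.Finite ∧ e.targetᶜ.Finite

/-- The set where two partial bijections are both defined and agree. -/
def nearAgree (e e' : PartialEquiv X X) : Set X :=
  {x | x ∈ e.source ∧ x ∈ e'.source ∧ e x = e' x}

theorem mem_nearAgree {e e' : PartialEquiv X X} {x : X} :
    x ∈ nearAgree e e' ↔ x ∈ e.source ∧ x ∈ e'.source ∧ e x = e' x := Iff.rfl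

/-- Two partial bijections coincide on a cofinite set (where both are defined). -/
def NearEqv (e e' : PartialEquiv X X) : Prop := (nearAgree e e')ᶜ.Finite

theorem isCofinBij_refl : IsCofinBij (PartialEquiv.refl X) := by
  constructor
  · rw [PartialEquiv.refl_source, compl_univ]; exact finite_empty
  · rw [PartialEquiv.refl_target, compl_univ]; exact finite_empty

theorem IsCofinBij.symm {e : PartialEquiv X X} (h : IsCofinBij e) : IsCofinBij e.symm := by
  constructor
  · rw [PartialEquiv.symm_source]; exact h.2
  · rw [PartialEquiv.symm_target]; exact h.1

theorem trans_source_compl_finite {e e' : PartialEquiv X X}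
    (h : e.sourceᶜ.Finite) (h' : e'.sourceᶜ.Finite) : (e.trans e').sourceᶜ.Finite := by
  have hsub : (e.trans e').sourceᶜ ⊆ e.sourceᶜ ∪ (e.source ∩ ⇑e ⁻¹' e'.sourceᶜ) := by
    intro x hx
    by_cases hxe : x ∈ e.source
    · refine mem_union_right _ (mem_inter hxe ?_)
      rw [mem_preimage, mem_compl_iff]
      intro hmem
      exact hx (by rw [PartialEquiv.trans_source]; exact ⟨hxe, hmem⟩)
    · exact mem_union_left _ hxe
  refine Set.Finite.subset (h.union ?_) hsub
  refine Set.Finite.of_finite_image (Set.Finite.subset h' ?_) (e.injOn.mono inter_subset_left)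
  rintro y ⟨x, ⟨_, hxp⟩, rfl⟩
  exact hxp

theorem IsCofinBij.trans {e e' : PartialEquiv X X} (h : IsCofinBij e) (h' : IsCofinBij e') :
    IsCofinBij (e.trans e') := by
  refine ⟨trans_source_compl_finite h.1 h'.1, ?_⟩
  have key : (e.trans e').target = (e'.symm.trans e.symm).source := by
    rw [PartialEquiv.trans_target, PartialEquiv.trans_source, PartialEquiv.symm_source,
      PartialEquiv.symm_source]
  rw [key]
  refine trans_source_compl_finite ?_ ?_
  · rw [PartialEquiv.symm_source]; exact h'.2
  · rw [PartialEquiv.symm_source]; exact h.2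

theorem nearEqv_refl_of {e : PartialEquiv X X} (h : e.sourceᶜ.Finite) : NearEqv e e := by
  refine Set.Finite.subset h fun x hx => ?_
  rw [mem_compl_iff] at hx ⊢
  intro hs
  exact hx (mem_nearAgree.mpr ⟨hs, hs, rfl⟩)

theorem NearEqv.symm {e e' : PartialEquiv X X} (h : NearEqv e e') : NearEqv e' e := by
  refine Set.Finite.subset h fun x hx => ?_
  rw [mem_compl_iff] at hx ⊢
  intro hs
  obtain ⟨h1, h2, h3⟩ := mem_nearAgree.mp hs
  exact hx (mem_nearAgree.mpr ⟨h2, h1, h3.symm⟩)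

theorem NearEqv.trans {e₁ e₂ e₃ : PartialEquiv X X}
    (h12 : NearEqv e₁ e₂) (h23 : NearEqv e₂ e₃) : NearEqv e₁ e₃ := by
  refine Set.Finite.subset (h12.union h23) fun x hx => ?_
  rw [mem_compl_iff] at hx
  rw [mem_union, mem_compl_iff, mem_compl_iff]
  by_contra hc
  push_neg at hc
  obtain ⟨ha, hb⟩ := hc
  obtain ⟨ha1, ha2, ha3⟩ := mem_nearAgree.mp ha
  obtain ⟨hb1, hb2, hb3⟩ := mem_nearAgree.mp hb
  exact hx (mem_nearAgree.mpr ⟨ha1, hb2, ha3.trans hb3⟩)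

instance nearSetoid (X : Type u) : Setoid { e : PartialEquiv X X // IsCofinBij e } where
  r a b := NearEqv a.1 b.1
  iseqv := by
    constructor
    · intro a; exact nearEqv_refl_of a.2.1
    · intro a b h; exact h.symm
    · intro a b c h h'; exact h.trans h'

/-- The near symmetric group of `X`: bijections between cofinite subsets of `X`, two of
them being identified when they coincide on a cofinite subset. -/
def NearPerm (X : Type u) : Type u := Quotient (nearSetoid X)

/-- The class in `NearPerm X` of a cofinite-partial bijection; i.e. `e` is a
representative of `NearPerm.mk e he`. -/
def NearPerm.mk (e : PartialEquiv X X) (he : IsCofinBij e) : NearPerm X :=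
  Quotient.mk (nearSetoid X) ⟨e, he⟩

theorem nearEqv_trans_congr {a a' b b' : PartialEquiv X X}
    (haa : NearEqv a a') (hbb : NearEqv b b') :
    NearEqv (b.trans a) (b'.trans a') := by
  have hfin2 : (b.source ∩ ⇑b ⁻¹' (nearAgree a a')ᶜ).Finite := by
    refine Set.Finite.of_finite_image (Set.Finite.subset haa ?_)
      (b.injOn.mono inter_subset_left)
    rintro y ⟨x, ⟨_, hxp⟩, rfl⟩
    exact hxp
  refine Set.Finite.subset (hbb.union hfin2) fun x hx => ?_
  rw [mem_compl_iff] at hx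
  by_cases hA : x ∈ nearAgree b b'
  · obtain ⟨hb1, hb2, hb3⟩ := mem_nearAgree.mp hA
    refine mem_union_right _ (mem_inter hb1 ?_)
    rw [mem_preimage, mem_compl_iff]
    intro hB
    obtain ⟨ha1, ha2, ha3⟩ := mem_nearAgree.mp hB
    refine hx (mem_nearAgree.mpr ⟨?_, ?_, ?_⟩)
    · rw [PartialEquiv.trans_source]; exact ⟨hb1, ha1⟩
    · rw [PartialEquiv.trans_source]
      refine ⟨hb2, ?_⟩
      rw [mem_preimage, ← hb3]
      exact ha2
    · rw [PartialEquiv.trans_apply, PartialEquiv.trans_apply, ← hb3, ha3]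
  · exact mem_union_left _ hA

theorem nearEqv_symm_congr {e e' : PartialEquiv X X} (he : IsCofinBij e)
    (h : NearEqv e e') : NearEqv e.symm e'.symm := by
  have h1 : (⇑e '' nearAgree e e')ᶜ.Finite := by
    have hsub : (⇑e '' nearAgree e e')ᶜ ⊆
        e.targetᶜ ∪ (e.target ∩ ⇑e.symm ⁻¹' (nearAgree e e')ᶜ) := by
      intro y hy
      by_cases hyt : y ∈ e.target
      · refine mem_union_right _ (mem_inter hyt ?_)
        rw [mem_preimage, mem_compl_iff]
        intro hmem
        rw [mem_compl_iff] at hy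
        exact hy ⟨e.symm y, hmem, e.right_inv hyt⟩
      · exact mem_union_left _ hyt
    refine Set.Finite.subset (Set.Finite.union he.2 ?_) hsub
    refine Set.Finite.of_finite_image (f := ⇑e.symm) (Set.Finite.subset h ?_) ?_
    · rintro z ⟨y, ⟨_, hyp⟩, rfl⟩
      exact hyp
    · refine e.symm.injOn.mono ?_
      rw [PartialEquiv.symm_source]
      exact inter_subset_left
  refine Set.Finite.subset h1 (compl_subset_compl.mpr ?_)
  rintro y ⟨x, hx, rfl⟩
  obtain ⟨hx1, hx2, hx3⟩ := mem_nearAgree.mp hx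
  refine mem_nearAgree.mpr ⟨?_, ?_, ?_⟩
  · rw [PartialEquiv.symm_source]; exact e.map_source hx1
  · rw [PartialEquiv.symm_source, hx3]; exact e'.map_source hx2
  · rw [e.left_inv hx1, hx3, e'.left_inv hx2]

instance : Group (NearPerm X) where
  mul f g :=
    Quotient.liftOn₂ f g
      (fun a b => Quotient.mk (nearSetoid X) ⟨b.1.trans a.1, b.2.trans a.2⟩)
      (fun _ _ _ _ ha hb => Quotient.sound (nearEqv_trans_congr ha hb))
  one := Quotient.mk (nearSetoid X) ⟨PartialEquiv.refl X, isCofinBij_refl⟩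
  inv f :=
    Quotient.map (fun a => ⟨a.1.symm, a.2.symm⟩)
      (fun a _ h => nearEqv_symm_congr a.2 h) f
  mul_assoc f g h := by
    refine Quotient.inductionOn₃ f g h fun a b c => ?_
    exact congrArg (Quotient.mk _) (Subtype.ext (PartialEquiv.trans_assoc _ _ _).symm)
  one_mul f := by
    refine Quotient.inductionOn f fun a => ?_
    exact congrArg (Quotient.mk _) (Subtype.ext (PartialEquiv.trans_refl _))
  mul_one f := by
    refine Quotient.inductionOn f fun a => ?_
    exact congrArg (Quotient.mk _) (Subtype.ext (PartialEquiv.refl_trans _))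
  inv_mul_cancel f := by
    refine Quotient.inductionOn f fun a => ?_
    apply Quotient.sound
    show NearEqv (a.1.trans a.1.symm) (PartialEquiv.refl X)
    refine Set.Finite.subset a.2.1 (compl_subset_compl.mpr ?_)
    intro x hx
    refine mem_nearAgree.mpr ⟨?_, ?_, ?_⟩
    · rw [PartialEquiv.trans_source]
      refine ⟨hx, ?_⟩
      rw [mem_preimage, PartialEquiv.symm_source]
      exact a.1.map_source hx
    · rw [PartialEquiv.refl_source]; exact mem_univ x
    · rw [PartialEquiv.trans_apply, a.1.left_inv hx, PartialEquiv.refl_coe, id_eq]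

/-- A group is finitely presented if it is (isomorphic to) the quotient of a free group
of finite rank by the normal closure of a finite subset. -/
def IsFinitelyPresentedGroup (G : Type w) [Group G] : Prop :=
  ∃ (n : ℕ) (R : Finset (FreeGroup (Fin n))) (φ : FreeGroup (Fin n) →* G),
    Function.Surjective φ ∧
    φ.ker = Subgroup.normalClosure (R : Set (FreeGroup (Fin n)))

/-- The edge relation of the near Schreier graph on `X` determined by partial bijections
`σ s`, `s ∈ S`: `x` and `y` are adjacent if `y = σ s x` or `x = σ s y` for some `s ∈ S`. -/
def graphStep {G : Type w} {X : Type u} (S : Set G) (σ : G → PartialEquiv X X)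
    (x y : X) : Prop :=
  ∃ s ∈ S, (x ∈ (σ s).source ∧ σ s x = y) ∨ (y ∈ (σ s).source ∧ σ s y = x)

/-- The partition of `X` into the connected components of the near Schreier graph. -/
def graphSetoid {G : Type w} {X : Type u} (S : Set G) (σ : G → PartialEquiv X X) :
    Setoid X :=
  Relation.EqvGen.setoid (graphStep S σ)

theorem NearPerm.mk_eq_mk {e e' : PartialEquiv X X} {he : IsCofinBij e} {he' : IsCofinBij e'} :
    NearPerm.mk e he = NearPerm.mk e' he' ↔ NearEqv e e' :=
  Quotient.eq

theorem NearPerm.exists_mk (a : NearPerm X) : ∃ e he, NearPerm.mk (X := X) e he = a :=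
  Quotient.inductionOn a fun e => ⟨e.1, e.2, rfl⟩

theorem NearPerm.one_eq_mk :
    (1 : NearPerm X) = NearPerm.mk (PartialEquiv.refl X) isCofinBij_refl := rfl

theorem NearPerm.mk_mul_mk {e e' : PartialEquiv X X} (he : IsCofinBij e) (he' : IsCofinBij e') :
    NearPerm.mk e he * NearPerm.mk e' he' = NearPerm.mk (e'.trans e) (he'.trans he) := rfl

theorem NearPerm.inv_mk {e : PartialEquiv X X} (he : IsCofinBij e) :
    (NearPerm.mk e he)⁻¹ = NearPerm.mk e.symm he.symm := rfl

theorem NearEqv.finite_ne {e e' : PartialEquiv X X} (h : NearEqv e e') :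
    {x | e x ≠ e' x}.Finite :=
  h.subset fun _ hx hmem => hx hmem.2.2

/-- A partial bijection preserving a subset `A` of its source and target agrees on `A` with
a permutation which is the identity outside `A`. -/
theorem PartialEquiv.exists_perm_eqOn (e : PartialEquiv X X) {A : Set X}
    (hs : A ⊆ e.source) (ht : A ⊆ e.target) (hm : ∀ x ∈ A, e x ∈ A)
    (hm' : ∀ x ∈ A, e.symm x ∈ A) :
    ∃ p : Equiv.Perm X, (∀ x ∈ A, p x = e x) ∧ ∀ x ∉ A, p x = x := by
  classical
  refine ⟨⟨fun x => if x ∈ A then e x else x, fun x => if x ∈ A then e.symm x else x,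
    fun x => ?_, fun x => ?_⟩, fun x hx => if_pos hx, fun x hx => if_neg hx⟩
  · by_cases hx : x ∈ A
    · simp [hx, hm x hx, e.left_inv (hs hx)]
    · simp [hx]
  · by_cases hx : x ∈ A
    · simp [hx, hm' x hx, e.right_inv (ht hx)]
    · simp [hx]

/-- If permutations attached to the generators of a free group move points only within the
classes of an equivalence relation, so does every element of the free group. -/
theorem FreeGroup.lift_perm_rel {ι : Type*} (r : Setoid X) (p : ι → Equiv.Perm X)
    (hp : ∀ i x, r (p i x) x) (w : FreeGroup ι) (x : X) : r (FreeGroup.lift p w x) x := by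
  induction w using FreeGroup.induction_on generalizing x with
  | C1 => simp
  | of i => simpa using hp i x
  | inv_of i h =>
    have := hp i ((p i)⁻¹ x)
    rw [← Equiv.Perm.mul_apply, mul_inv_cancel, Equiv.Perm.one_apply] at this
    simpa using r.symm this
  | mul a b ha hb =>
    rw [_root_.map_mul, Equiv.Perm.mul_apply]
    exact r.trans (ha _) (hb x)

/-- If an action of a free group by permutations preserves `A` and represents a near action
on `A` up to finite error for the generators, then it does so for every element. -/
theorem finite_lift_perm_ne {ι : Type*} (ψ : FreeGroup ι →* NearPerm X)
    (p : ι → Equiv.Perm X) {A : Set X} (hA : ∀ w, ∀ x ∈ A, FreeGroup.lift p w x ∈ A)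
    (hp : ∀ i, ∃ e he, NearPerm.mk e he = ψ (FreeGroup.of i) ∧ ∀ x ∈ A, p i x = e x)
    (w : FreeGroup ι) (e : PartialEquiv X X) (he : IsCofinBij e)
    (hw : NearPerm.mk e he = ψ w) : {x ∈ A | FreeGroup.lift p w x ≠ e x}.Finite := by
  have inv_case (w : FreeGroup ι)
      (ih : ∀ e he, NearPerm.mk e he = ψ w → {x ∈ A | FreeGroup.lift p w x ≠ e x}.Finite)
      (e : PartialEquiv X X) (he : IsCofinBij e) (hw : NearPerm.mk e he = ψ w⁻¹) :
      {x ∈ A | FreeGroup.lift p w⁻¹ x ≠ e x}.Finite := by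
    have h1 := ih e.symm he.symm (by rw [← NearPerm.inv_mk he, hw, map_inv, inv_inv])
    refine ((h1.union he.2).preimage (FreeGroup.lift p w⁻¹).injective.injOn).subset ?_
    rintro x ⟨hx, hne⟩
    by_contra hc
    simp only [mem_preimage, mem_union, mem_ofPred_eq, mem_compl_iff, not_or, not_and,
      not_not] at hc
    have h2 := hc.1 (hA _ x hx)
    rw [← Equiv.Perm.mul_apply, ← map_mul, mul_inv_cancel, map_one, Equiv.Perm.one_apply] at h2
    refine hne ?_
    conv_rhs => rw [h2]
    exact (e.right_inv hc.2).symm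
  induction w using FreeGroup.induction_on generalizing e with
  | C1 =>
    rw [map_one, NearPerm.one_eq_mk, NearPerm.mk_eq_mk] at hw
    refine hw.symm.finite_ne.subset ?_
    rintro x ⟨-, hx⟩
    simpa using hx
  | of i =>
    obtain ⟨e', he', h1, h2⟩ := hp i
    rw [← h1, NearPerm.mk_eq_mk] at hw
    refine hw.symm.finite_ne.subset ?_
    rintro x ⟨hxA, hx⟩
    rwa [FreeGroup.lift_apply_of, h2 x hxA] at hx
  | inv_of i h => exact inv_case _ h e he hw
  | mul a b ha hb =>
    obtain ⟨ea, hea, h1⟩ := NearPerm.exists_mk (ψ a)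
    obtain ⟨eb, heb, h2⟩ := NearPerm.exists_mk (ψ b)
    rw [map_mul, ← h1, ← h2, NearPerm.mk_mul_mk, NearPerm.mk_eq_mk] at hw
    refine ((hw.symm.finite_ne.union (hb eb heb h2)).union
      ((ha ea hea h1).preimage (FreeGroup.lift p b).injective.injOn)).subset ?_
    rintro x ⟨hxA, hx⟩
    by_contra hc
    simp only [mem_preimage, mem_union, mem_ofPred_eq, not_or, not_and, not_not] at hc
    obtain ⟨⟨h3, h4⟩, h5⟩ := hc
    refine hx ?_
    rw [map_mul, Equiv.Perm.mul_apply, h5 (hA b x hxA), h4 hxA, ← h3]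
    rfl

/-- The union of the classes of an equivalence relation which do not meet `B`. -/
def Setoid.avoiding (r : Setoid X) (B : Set X) : Set X := {x | ∀ b ∈ B, ¬ r x b}

theorem Setoid.mem_avoiding_of_rel {r : Setoid X} {B : Set X} {x y : X} (h : r y x)
    (hx : x ∈ r.avoiding B) : y ∈ r.avoiding B :=
  fun b hb hyb => hx b hb (r.trans (r.symm h) hyb)

theorem Setoid.notMem_of_mem_avoiding {r : Setoid X} {B : Set X} {x : X}
    (hx : x ∈ r.avoiding B) : x ∉ B :=
  fun hB => hx x hB (r.refl x)

theorem Setoid.finite_image_compl_avoiding (r : Setoid X) {B : Set X} (hB : B.Finite) :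
    (Quotient.mk r '' (r.avoiding B)ᶜ).Finite := by
  refine (hB.image (Quotient.mk r)).subset ?_
  rintro _ ⟨x, hx, rfl⟩
  simp only [Setoid.avoiding, mem_compl_iff, mem_ofPred_eq, not_forall, not_not] at hx
  obtain ⟨b, hb, hxb⟩ := hx
  exact ⟨b, hb, Quotient.sound (r.symm hxb)⟩

/-- The restriction of an action by permutations to an invariant subset. -/
def MonoidHom.permRestrict {F : Type*} [Group F] (γ : F →* Equiv.Perm X) (Y : Set X)
    (hY : ∀ w x, γ w x ∈ Y ↔ x ∈ Y) : F →* Equiv.Perm Y where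
  toFun w := (γ w).subtypePerm (hY w)
  map_one' := by ext; simp
  map_mul' a b := by
    ext x
    exact congrArg (fun f : Equiv.Perm X => f x) (map_mul γ a b)

/-- Every near action of a finitely presented group is the disjoint union of a
realizable near action and a near action of finite type: there are a finite generating
set `S` of `G`, representatives `σ s` of `α s` for `s ∈ S`, and a subset `Y` of `X`,
contained in the source and target of each `σ s` and invariant under each `σ s`,
carrying an honest `G`-action `β` which restricts each `σ s` and represents `α` up to
finite error, such that all but finitely many connected components of the near Schreier
graph are contained in `Y`. -/
theorem near_action_of_finitely_presented_group_splits
    {G : Type w} [Group G] (hG : IsFinitelyPresentedGroup G)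
    {X : Type u} (α : G →* NearPerm X) :
    ∃ S : Finset G, Subgroup.closure (S : Set G) = ⊤ ∧
      ∃ (σ : G → PartialEquiv X X) (hσ : ∀ s ∈ S, IsCofinBij (σ s)),
        (∀ s (hs : s ∈ S), NearPerm.mk (σ s) (hσ s hs) = α s) ∧
        ∃ Y : Set X,
          (∀ s ∈ S, Y ⊆ (σ s).source ∧ Y ⊆ (σ s).target ∧ ⇑(σ s) '' Y = Y) ∧
          (∃ β : G →* Equiv.Perm Y,
            (∀ s ∈ S, ∀ y : Y, ((β s y : X)) = σ s (y : X)) ∧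
            (∀ (g : G) (e : PartialEquiv X X) (he : IsCofinBij e),
              NearPerm.mk e he = α g →
              {y : Y | ((β g y : X)) ≠ e (y : X)}.Finite)) ∧
          Set.Finite (Quotient.mk (graphSetoid (S : Set G) σ) '' Yᶜ) := by
  classical
  obtain ⟨n, R, φ, hφ, hker⟩ := hG
  choose σ hσ hσα using fun g => NearPerm.exists_mk (α g)
  let s : Fin n → G := fun i => φ (FreeGroup.of i)
  let S : Finset G := Finset.univ.image s
  have hsS (i : Fin n) : s i ∈ S := Finset.mem_image_of_mem _ (Finset.mem_univ i)
  have hS : ∀ g ∈ S, ∃ i, s i = g := fun g hg => by simpa [S] using hg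
  let r := graphSetoid (S : Set G) σ
  have hr (i : Fin n) {x : X} (hx : x ∈ (σ (s i)).source) : r (σ (s i) x) x :=
    Relation.EqvGen.rel _ _ ⟨s i, hsS i, Or.inr ⟨hx, rfl⟩⟩
  have hr' (i : Fin n) {x : X} (hx : x ∈ (σ (s i)).target) : r ((σ (s i)).symm x) x := by
    have := hr i ((σ (s i)).map_target hx)
    rw [(σ (s i)).right_inv hx] at this
    exact r.symm this
  let B₀ : Set X := ⋃ i, ((σ (s i)).sourceᶜ ∪ (σ (s i)).targetᶜ)
  have hB₀ : B₀.Finite := finite_iUnion fun i => (hσ (s i)).1.union (hσ (s i)).2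
  have hst {C : Set X} (hC : B₀ ⊆ C) (i : Fin n) :
      r.avoiding C ⊆ (σ (s i)).source ∩ (σ (s i)).target := by
    intro x hx
    have h1 : x ∉ B₀ := fun h => Setoid.notMem_of_mem_avoiding hx (hC h)
    simp only [B₀, mem_iUnion, mem_union, mem_compl_iff, not_exists, not_or, not_not] at h1
    exact h1 i
  have hst₀ := hst subset_rfl
  let A := r.avoiding B₀
  choose p hp hp' using fun i => (σ (s i)).exists_perm_eqOn (A := A)
    (fun x hx => (hst₀ i hx).1) (fun x hx => (hst₀ i hx).2)
    (fun x hx => Setoid.mem_avoiding_of_rel (hr i (hst₀ i hx).1) hx)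
    (fun x hx => Setoid.mem_avoiding_of_rel (hr' i (hst₀ i hx).2) hx)
  have hγr := FreeGroup.lift_perm_rel r p fun i x => by
    by_cases hx : x ∈ A
    · rw [hp i x hx]; exact hr i (hst₀ i hx).1
    · rw [hp' i x hx]
  have hγA (w : FreeGroup (Fin n)) (x : X) (hx : x ∈ A) : FreeGroup.lift p w x ∈ A :=
    Setoid.mem_avoiding_of_rel (hγr w x) hx
  have hnear := finite_lift_perm_ne (α.comp φ) p hγA
    fun i => ⟨σ (s i), hσ (s i), hσα (s i), hp i⟩
  let B : Set X := B₀ ∪ ⋃ w ∈ R, {x ∈ A | FreeGroup.lift p w x ≠ x}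
  have hB : B.Finite := by
    refine hB₀.union (R.finite_toSet.biUnion fun w hw => ?_)
    refine hnear w (PartialEquiv.refl X) isCofinBij_refl ?_
    have hw1 : φ w = 1 := by
      rw [← MonoidHom.mem_ker, hker]
      exact Subgroup.subset_normalClosure hw
    rw [MonoidHom.comp_apply, hw1, map_one, NearPerm.one_eq_mk]
  let Y := r.avoiding B
  have hYA : Y ⊆ A := fun x hx b hb => hx b (Or.inl hb)
  have hstY := hst (C := B) subset_union_left
  have hY (w : FreeGroup (Fin n)) (x : X) : FreeGroup.lift p w x ∈ Y ↔ x ∈ Y :=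
    ⟨Setoid.mem_avoiding_of_rel (r.symm (hγr w x)), Setoid.mem_avoiding_of_rel (hγr w x)⟩
  let γ := (FreeGroup.lift p).permRestrict Y hY
  have hγ : φ.ker ≤ γ.ker := by
    rw [hker]
    refine Subgroup.normalClosure_le_normal fun w hw => ?_
    rw [SetLike.mem_coe, MonoidHom.mem_ker]
    ext ⟨x, hx⟩
    by_contra hne
    exact Setoid.notMem_of_mem_avoiding hx (Or.inr (mem_biUnion hw ⟨hYA hx, hne⟩))
  let β : G →* Equiv.Perm Y := φ.liftOfSurjective hφ ⟨γ, hγ⟩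
  have hβ (w : FreeGroup (Fin n)) (y : Y) : (β (φ w) y : X) = FreeGroup.lift p w y := by
    have : β (φ w) = γ w := φ.liftOfRightInverse_comp_apply _ _ ⟨γ, hγ⟩ w
    rw [this]
    rfl
  refine ⟨S, ?_, σ, fun g _ => hσ g, fun g _ => hσα g, Y, fun g hg => ?_,
    ⟨β, fun g hg y => ?_, fun g e he hg => ?_⟩, r.finite_image_compl_avoiding hB⟩
  · have : (S : Set G) = φ '' range FreeGroup.of := by
      rw [← range_comp]
      simp [S, s, Function.comp_def]
    rw [this, ← MonoidHom.map_closure, FreeGroup.closure_range_of, ← MonoidHom.range_eq_map,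
      MonoidHom.range_eq_top.mpr hφ]
  · obtain ⟨i, rfl⟩ := hS g hg
    refine ⟨fun x hx => (hstY i hx).1, fun x hx => (hstY i hx).2, Subset.antisymm ?_ ?_⟩
    · rintro _ ⟨x, hx, rfl⟩
      exact Setoid.mem_avoiding_of_rel (hr i (hstY i hx).1) hx
    · intro x hx
      exact ⟨(σ (s i)).symm x, Setoid.mem_avoiding_of_rel (hr' i (hstY i hx).2) hx,
        (σ (s i)).right_inv (hstY i hx).2⟩
  · obtain ⟨i, rfl⟩ := hS g hg
    rw [hβ, FreeGroup.lift_apply_of, hp i y (hYA y.2)]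
  · obtain ⟨w, rfl⟩ := hφ g
    refine ((hnear w e he hg).preimage Subtype.val_injective.injOn).subset fun y hy => ?_
    rw [mem_ofPred_eq, hβ] at hy
    exact ⟨hYA y.2, hy⟩
end

section
/- Let Γ be a finitely generated group. The following are equivalent: (i) Γ is profinitely finitely presented, i.e., there exist a finitely presented group Λ and a surjective group homomorphism p : Λ → Γ whose kernel is contained in every finite-index normal subgroup of Λ (equivalently, p induces an isomorphism of profinite completions); (ii) for every family (F_i)_{i∈I} of finite groups, every group homomorphism Γ → (∏_{i∈I} F_i)/(⊕_{i∈I} F_i) lifts to a group homomorphism Γ → ∏_{i∈I} F_i. -/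
universe u

/-- A finitely generated group `Γ` is profinitely finitely presented if there is a
finitely presented group `Λ` with a surjection `p : Λ → Γ` whose kernel is contained in
every finite-index normal subgroup of `Λ` (i.e. `p` induces an isomorphism of profinite
completions).  Unfolded presentation-free form: there are `n`, a finite set `R` of
relators in the free group on `n` generators, and a surjection `φ` onto `Γ` killing `R`,
such that the kernel of φ is contained in every finite-index normal subgroup containing
the normal closure of `R` (so that, with `Λ` the quotient of the free group by the
normal closure of `R`, the induced surjection `Λ → Γ` has kernel contained in every
finite-index normal subgroup of `Λ`). -/
def ProfinitelyFinitelyPresented (Γ : Type u) [Group Γ] : Prop :=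
  ∃ (n : ℕ) (R : Finset (FreeGroup (Fin n))) (φ : FreeGroup (Fin n) →* Γ),
    Function.Surjective φ ∧
    Subgroup.normalClosure (R : Set (FreeGroup (Fin n))) ≤ φ.ker ∧
    ∀ N : Subgroup (FreeGroup (Fin n)), N.Normal → N.FiniteIndex →
      Subgroup.normalClosure (R : Set (FreeGroup (Fin n))) ≤ N → φ.ker ≤ N

/-- The restricted direct product `⊕ᵢ Fᵢ` inside the direct product `∏ᵢ Fᵢ`: the
subgroup of families with all but finitely many coordinates trivial. -/
def restrictedProduct (I : Type u) (F : I → Type u) [∀ i, Group (F i)] :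
    Subgroup (∀ i, F i) where
  carrier := {f | {i | f i ≠ 1}.Finite}
  one_mem' := by
    refine Set.Finite.subset Set.finite_empty fun i hi => ?_
    exact absurd rfl hi
  mul_mem' := by
    intro f g hf hg
    refine Set.Finite.subset (Set.Finite.union hf hg) fun i hi => ?_
    simp only [Set.mem_setOf_eq, Pi.mul_apply] at hi
    by_cases h : f i = 1
    · refine Set.mem_union_right _ ?_
      simp only [Set.mem_setOf_eq]
      intro hg1
      exact hi (by rw [h, hg1, one_mul])
    · exact Set.mem_union_left _ h
  inv_mem' := by
    intro f hf
    refine Set.Finite.subset hf fun i hi => ?_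
    simp only [Set.mem_setOf_eq, Pi.inv_apply] at hi ⊢
    intro h
    exact hi (by rw [h, inv_one])

instance restrictedProduct_normal (I : Type u) (F : I → Type u) [∀ i, Group (F i)] :
    (restrictedProduct I F).Normal := by
  constructor
  intro f hf g
  have hf' : {i | f i ≠ 1}.Finite := hf
  show {i | (g * f * g⁻¹) i ≠ 1}.Finite
  refine Set.Finite.subset hf' fun i hi => ?_
  simp only [Set.mem_setOf_eq, Pi.mul_apply, Pi.inv_apply] at hi ⊢
  intro h
  exact hi (by rw [h, mul_one, mul_inv_cancel])

theorem mem_restrictedProduct_iff {I : Type u} {F : I → Type u} [∀ i, Group (F i)]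
    {f : ∀ i, F i} : f ∈ restrictedProduct I F ↔ {i | f i ≠ 1}.Finite :=
  Iff.rfl

/-- Two homomorphisms from a free group of finite rank to a product which agree modulo the
restricted product agree in all but finitely many coordinates. -/
theorem finite_setOf_evalMonoidHom_comp_ne {α : Type*} [Finite α] {I : Type u}
    {F : I → Type u} [∀ i, Group (F i)] (f g : FreeGroup α →* ∀ i, F i)
    (h : (QuotientGroup.mk' (restrictedProduct I F)).comp f =
      (QuotientGroup.mk' (restrictedProduct I F)).comp g) :
    {i | (Pi.evalMonoidHom F i).comp f ≠ (Pi.evalMonoidHom F i).comp g}.Finite := by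
  have key (a : α) : {i | ((f (.of a))⁻¹ * g (.of a)) i ≠ 1}.Finite :=
    mem_restrictedProduct_iff.mp (QuotientGroup.eq.mp (DFunLike.congr_fun h (.of a)))
  refine (Set.finite_iUnion key).subset fun i hi => ?_
  by_contra hcon
  refine hi (FreeGroup.ext_hom _ _ fun a => ?_)
  by_contra hne
  refine hcon (Set.mem_iUnion.mpr ⟨a, fun h1 => hne ?_⟩)
  exact inv_mul_eq_one.mp h1

theorem ProfinitelyFinitelyPresented.exists_lift {Γ : Type u} [Group Γ]
    (h : ProfinitelyFinitelyPresented Γ) {I : Type u} {F : I → Type u} [∀ i, Group (F i)]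
    [∀ i, Finite (F i)] (φ : Γ →* (∀ i, F i) ⧸ restrictedProduct I F) :
    ∃ ψ : Γ →* ∀ i, F i, (QuotientGroup.mk' (restrictedProduct I F)).comp ψ = φ := by
  classical
  obtain ⟨n, R, π, hπ, hR, hN⟩ := h
  choose s hs using QuotientGroup.mk'_surjective (restrictedProduct I F)
  let f : FreeGroup (Fin n) →* ∀ i, F i := FreeGroup.lift fun a => s (φ (π (.of a)))
  have hf : (QuotientGroup.mk' (restrictedProduct I F)).comp f = φ.comp π :=
    FreeGroup.ext_hom _ _ fun a => by
      simp only [f, MonoidHom.comp_apply, FreeGroup.lift_apply_of, hs]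
  have hfin : {i | ¬ π.ker ≤ ((Pi.evalMonoidHom F i).comp f).ker}.Finite := by
    have key (r : FreeGroup (Fin n)) (hr : r ∈ R) : {i | f r i ≠ 1}.Finite := by
      refine mem_restrictedProduct_iff.mp ((QuotientGroup.eq_one_iff _).mp ?_)
      have hr1 : π r = 1 := hR (Subgroup.subset_normalClosure hr)
      simpa [hr1] using DFunLike.congr_fun hf r
    refine (R.finite_toSet.biUnion key).subset fun i hi => ?_
    by_contra hcon
    simp only [Set.mem_iUnion, not_exists, Set.mem_ofPred_eq, not_not] at hcon
    exact hi (hN _ inferInstance inferInstance (Subgroup.normalClosure_le_normal hcon))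
  let g : FreeGroup (Fin n) →* ∀ i, F i := MonoidHom.pi fun i =>
    if π.ker ≤ ((Pi.evalMonoidHom F i).comp f).ker then (Pi.evalMonoidHom F i).comp f else 1
  have hg : π.ker ≤ g.ker := fun x hx => by
    refine MonoidHom.mem_ker.mpr (funext fun i => ?_)
    by_cases hi : π.ker ≤ ((Pi.evalMonoidHom F i).comp f).ker
    · simpa [g, hi] using hi hx
    · simp [g, hi]
  refine ⟨π.liftOfSurjective hπ ⟨g, hg⟩, ?_⟩
  refine (MonoidHom.cancel_right hπ).mp ?_
  rw [← hf, MonoidHom.comp_assoc, MonoidHom.liftOfRightInverse_comp]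
  ext x
  refine QuotientGroup.eq.mpr (mem_restrictedProduct_iff.mpr (hfin.subset fun i hi hle => hi ?_))
  simp [g, hle]

theorem profinitelyFinitelyPresented_of_lifting {Γ : Type u} [Group Γ] (hfg : Group.FG Γ)
    (h : ∀ (F : ULift.{u} ℕ → Type u) [∀ i, Group (F i)] [∀ i, Finite (F i)]
      (φ : Γ →* (∀ i, F i) ⧸ restrictedProduct (ULift.{u} ℕ) F),
      ∃ ψ : Γ →* ∀ i, F i, (QuotientGroup.mk' (restrictedProduct _ F)).comp ψ = φ) :
    ProfinitelyFinitelyPresented Γ := by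
  obtain ⟨α, _, π₀, hπ₀⟩ := Group.fg_iff_exists_freeGroup_hom_surjective_finite.mp hfg
  obtain ⟨n, ⟨ε⟩⟩ := Finite.exists_equiv_fin α
  obtain ⟨π, hπ⟩ : ∃ π : FreeGroup (Fin n) →* Γ, Function.Surjective π :=
    ⟨π₀.comp (FreeGroup.freeGroupCongr ε.symm).toMonoidHom,
      hπ₀.comp (FreeGroup.freeGroupCongr ε.symm).surjective⟩
  obtain ⟨e, he⟩ := exists_surjective_nat π.ker
  let R (k : ℕ) : Finset (FreeGroup (Fin n)) := (Finset.range k).image fun j => (e j).1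
  have hR (k : ℕ) : Subgroup.normalClosure (R k : Set (FreeGroup (Fin n))) ≤ π.ker := by
    refine Subgroup.normalClosure_le_normal fun x hx => ?_
    obtain ⟨j, -, rfl⟩ := Finset.mem_image.mp hx
    exact (e j).2
  by_contra hcon
  have hN (k : ℕ) : ∃ N : Subgroup (FreeGroup (Fin n)), N.Normal ∧ N.FiniteIndex ∧
      Subgroup.normalClosure (R k : Set (FreeGroup (Fin n))) ≤ N ∧ ¬ π.ker ≤ N := by
    by_contra! hk
    exact hcon ⟨n, R k, π, hπ, hR k, hk⟩
  choose N hnormal hindex hRN hker using hN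
  let F (i : ULift.{u} ℕ) : Type u := ULift.{u} (FreeGroup (Fin n) ⧸ N i.down)
  let f : FreeGroup (Fin n) →* ∀ i, F i := MonoidHom.pi fun i =>
    MulEquiv.ulift.symm.toMonoidHom.comp (QuotientGroup.mk' (N i.down))
  have hf (x : FreeGroup (Fin n)) (i : ULift.{u} ℕ) : f x i = 1 ↔ x ∈ N i.down := by
    rw [← QuotientGroup.eq_one_iff]
    exact (MulEquiv.ulift (α := FreeGroup (Fin n) ⧸ N i.down)).symm.map_eq_one_iff
  have hfker : π.ker ≤ ((QuotientGroup.mk' (restrictedProduct _ F)).comp f).ker := fun x hx => by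
    obtain ⟨j, hj⟩ := he ⟨x, hx⟩
    refine (QuotientGroup.eq_one_iff _).mpr (mem_restrictedProduct_iff.mpr ?_)
    refine ((Set.finite_Iic j).preimage ULift.down_injective.injOn).subset fun i hi => ?_
    by_contra hlt
    refine hi ((hf x i).mpr (hRN _ (Subgroup.subset_normalClosure ?_)))
    exact Finset.mem_image.mpr ⟨j, Finset.mem_range.mpr (not_le.mp hlt), by rw [hj]⟩
  obtain ⟨ψ, hψ⟩ := h F (π.liftOfSurjective hπ ⟨_, hfker⟩)
  have hfin := finite_setOf_evalMonoidHom_comp_ne f (ψ.comp π) <| by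
    rw [← MonoidHom.comp_assoc, hψ, MonoidHom.liftOfRightInverse_comp]
  obtain ⟨i, hi⟩ := hfin.exists_notMem
  refine hker i.down fun x hx => (hf x i).mp ?_
  have hx' : π x = 1 := hx
  simpa [hx'] using DFunLike.congr_fun (not_not.mp hi) x

/-- A finitely generated group is profinitely finitely presented if and only if, for
every family of finite groups `(Fᵢ)`, every homomorphism to `(∏ Fᵢ)/(⊕ Fᵢ)` lifts to a
homomorphism to `∏ Fᵢ`. -/
theorem profinitelyFinitelyPresented_iff_lifting
    {Γ : Type u} [Group Γ] (hfg : Group.FG Γ) :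
    ProfinitelyFinitelyPresented Γ ↔
      ∀ (I : Type u) (F : I → Type u) [∀ i, Group (F i)] [∀ i, Finite (F i)]
        (φ : Γ →* (∀ i, F i) ⧸ restrictedProduct I F),
        ∃ ψ : Γ →* ∀ i, F i, (QuotientGroup.mk' (restrictedProduct I F)).comp ψ = φ := by
  exact ⟨fun h I F _ _ φ => h.exists_lift φ,
    fun h => profinitelyFinitelyPresented_of_lifting hfg fun F _ _ φ => h _ F φ⟩
end

section
/- Fix an integer m ≥ 2 and let C_{m^∞} = ℤ[1/m]/ℤ be the m-quasicyclic group, realized as the subgroup {q + ℤ : q ∈ ℚ, m^k q ∈ ℤ for some k ≥ 0} of ℚ/ℤ. Let X be a free C_{m^∞}-set (for instance, C_{m^∞} acting on itself by translations) and let S be a nonempty finite subset of X. Then the near action of C_{m^∞} on X ∖ S is not realizable: there is no group homomorphism β : C_{m^∞} → Perm(X ∖ S) such that for every g ∈ C_{m^∞}, β(g)(x) = g·x for all but finitely many x ∈ X ∖ S. -/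
universe u

/-- The group `ℚ/ℤ`. -/
abbrev RatModInt : Type := ℚ ⧸ AddSubgroup.zmultiples (1 : ℚ)

/-- The `m`-quasicyclic group `C_{m^∞} = ℤ[1/m]/ℤ`, realized as the subgroup of `ℚ/ℤ`
of classes of rationals `q` with `m^k q ∈ ℤ` for some `k ≥ 0`, i.e. of elements killed
by some power of `m`. -/
def quasiCyclic (m : ℕ) : AddSubgroup RatModInt where
  carrier := {x : RatModInt | ∃ k : ℕ, ((m : ℤ) ^ k) • x = 0}
  zero_mem' := ⟨0, smul_zero _⟩
  add_mem' := by
    rintro a b ⟨k, hk⟩ ⟨l, hl⟩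
    refine ⟨k + l, ?_⟩
    rw [smul_add]
    have h1 : ((m : ℤ) ^ (k + l)) • a = 0 := by
      rw [pow_add, mul_comm, mul_smul, hk, smul_zero]
    have h2 : ((m : ℤ) ^ (k + l)) • b = 0 := by
      rw [pow_add, mul_smul, hl, smul_zero]
    rw [h1, h2, add_zero]
  neg_mem' := by
    rintro a ⟨k, hk⟩
    exact ⟨k, by rw [smul_neg, hk, neg_zero]⟩

/-- If all nonidentity elements of a finite group acting on a finite set have the same fixed
points, the rest of the set is a union of free orbits. -/
theorem card_modEq_ncard_of_fixedBy_eq {F α : Type*} [Group F] [Finite F] [Finite α]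
    [MulAction F α] (T : Set α) (hT : ∀ g : F, g ≠ 1 → MulAction.fixedBy α g = T) :
    Nat.card α ≡ T.ncard [MOD Nat.card F] := by
  classical
  cases nonempty_fintype F
  cases nonempty_fintype α
  have hBurnside := MulAction.sum_card_fixedBy_eq_card_orbits_mul_card_group F α
  rw [← Finset.add_sum_erase _ _ (Finset.mem_univ (1 : F))] at hBurnside
  have hone : Fintype.card (MulAction.fixedBy α (1 : F)) = Nat.card α := by
    rw [← Nat.card_eq_fintype_card, MulAction.fixedBy_one_eq_univ, Nat.card_univ]
  have hne : ∀ g ∈ Finset.univ.erase (1 : F),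
      Fintype.card (MulAction.fixedBy α g) = T.ncard := fun g hg => by
    rw [← Nat.card_eq_fintype_card, hT g (Finset.ne_of_mem_erase hg), Nat.card_coe_set_eq]
  rw [hone, Finset.sum_congr rfl hne, Finset.sum_const, smul_eq_mul,
    Finset.card_erase_of_mem (Finset.mem_univ _), Finset.card_univ,
    ← Nat.card_eq_fintype_card (α := F)] at hBurnside
  have hsum : Nat.card α + Nat.card F * T.ncard =
      T.ncard + Nat.card F * Fintype.card (Quotient (MulAction.orbitRel F α)) := by
    obtain ⟨c, hc⟩ : ∃ c, Nat.card F = c + 1 := Nat.exists_eq_succ_of_ne_zero Nat.card_pos.ne'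
    rw [hc] at hBurnside ⊢
    simp only [Nat.add_sub_cancel] at hBurnside
    linarith
  have h := congrArg (· % Nat.card F) hsum
  simpa [Nat.ModEq] using h

/-- The same, for an action by permutations restricted to a finite invariant set. -/
theorem ncard_modEq_ncard_of_invariant {F X : Type*} [Group F] [Finite F]
    (σ : F →* Equiv.Perm X) {B T : Set X} (hB : B.Finite) (hTB : T ⊆ B)
    (hinv : ∀ g, ∀ x ∈ B, σ g x ∈ B) (hT : ∀ g, g ≠ 1 → ∀ x ∈ B, σ g x = x ↔ x ∈ T) :
    B.ncard ≡ T.ncard [MOD Nat.card F] := by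
  have : Finite B := hB
  let _ : MulAction F B :=
    { smul := fun g x => ⟨σ g x, hinv g x x.2⟩
      one_smul := fun x => Subtype.ext <| by
        change σ 1 x = x
        simp
      mul_smul := fun g h x => Subtype.ext <| by
        change σ (g * h) x = σ g (σ h x)
        simp }
  have key := card_modEq_ncard_of_fixedBy_eq (F := F) (α := B) (Subtype.val ⁻¹' T)
    fun g hg => by
      ext x
      rw [MulAction.mem_fixedBy, Subtype.ext_iff]
      exact hT g hg x x.2
  rwa [Nat.card_coe_set_eq, Set.ncard_preimage_of_injective_subset_range
    Subtype.val_injective (by simpa using hTB)] at key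

/-- If an action of a finite group agrees with a free action outside a finite set and all
its nonidentity elements have the same fixed points, then the number of these is a multiple of
the order of the group. -/
theorem card_dvd_ncard_fixedPoints_of_near_free {F X : Type*} [Group F] [Finite F]
    (ρ σ : F →* Equiv.Perm X) (hρ : ∀ g x, ρ g x = x → g = 1)
    (hnear : ∀ g, {x | σ g x ≠ ρ g x}.Finite) {T : Set X}
    (hT : ∀ g, g ≠ 1 → ∀ x, σ g x = x ↔ x ∈ T) :
    Nat.card F ∣ T.ncard := by
  rcases subsingleton_or_nontrivial F with hF | hF
  · simp
  let A : Set X := {x | ∀ g, σ g x = ρ g x}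
  have hAσ : ∀ g, ∀ x ∈ A, σ g x ∈ A := fun g x hx h => by
    have h1 := hx (h * g)
    rw [map_mul, map_mul, Equiv.Perm.mul_apply, Equiv.Perm.mul_apply] at h1
    rw [h1, hx g]
  have hAρ : ∀ g, ∀ x ∈ A, ρ g x ∈ A := fun g x hx => hx g ▸ hAσ g x hx
  have hcompl : ∀ τ : F →* Equiv.Perm X, (∀ g, ∀ x ∈ A, τ g x ∈ A) →
      ∀ g, ∀ x ∈ Aᶜ, τ g x ∈ Aᶜ := fun τ hτ g x hx hgx => hx <| by
    simpa [← Equiv.Perm.mul_apply, ← map_mul] using hτ g⁻¹ _ hgx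
  have hfin : Aᶜ.Finite := by
    refine (Set.finite_iUnion hnear).subset fun x hx => ?_
    simpa [A] using hx
  have hTA : T ⊆ Aᶜ := fun x hx hxA => by
    obtain ⟨g, hg⟩ := exists_ne (1 : F)
    exact hg (hρ g x ((hxA g).symm.trans ((hT g hg x).2 hx)))
  have hσB := ncard_modEq_ncard_of_invariant σ hfin hTA (hcompl σ hAσ) fun g hg x _ => hT g hg x
  have hρB := ncard_modEq_ncard_of_invariant ρ hfin (Set.empty_subset _) (hcompl ρ hAρ)
    fun g hg x _ => by simpa using fun h => hg (hρ g x h)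
  rw [Set.ncard_empty] at hρB
  exact (Nat.modEq_zero_iff_dvd).1 (hσB.symm.trans hρB)

/-- An `m`-divisible `m`-power torsion abelian group has no proper subgroup of finite index. -/
theorem subgroup_eq_top_of_finiteIndex {G : Type*} [CommGroup G] (m : ℕ)
    (htors : ∀ g : G, ∃ k : ℕ, g ^ m ^ k = 1) (hdiv : ∀ (g : G) (k : ℕ), ∃ h, h ^ m ^ k = g)
    (H : Subgroup G) [H.FiniteIndex] : H = ⊤ := by
  refine (Subgroup.eq_top_iff' H).2 fun g => ?_
  choose h hh using hdiv g
  obtain ⟨a, ha⟩ := Finite.exists_infinite_fiber fun j => (h j : G ⧸ H)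
  rw [Set.infinite_coe_iff] at ha
  obtain ⟨i, hi⟩ := ha.nonempty
  obtain ⟨k, hk⟩ := htors (h i)
  obtain ⟨j, hj, hkj⟩ := ha.exists_gt k
  have hak : a ^ m ^ k = 1 := by
    rw [← show (h i : G ⧸ H) = a from hi, ← QuotientGroup.mk_pow, hk, QuotientGroup.mk_one]
  rw [← QuotientGroup.eq_one_iff, ← hh j, QuotientGroup.mk_pow,
    show (h j : G ⧸ H) = a from hj, ← Nat.add_sub_cancel' hkj.le, pow_add, pow_mul, hak, one_pow]

/-- In an action of an `m`-divisible `m`-power torsion abelian group, a point fixed by an element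
with finitely many fixed points is fixed by the whole group. -/
theorem fixed_of_finite_fixedBy {G X : Type*} [CommGroup G] (m : ℕ)
    (htors : ∀ g : G, ∃ k : ℕ, g ^ m ^ k = 1) (hdiv : ∀ (g : G) (k : ℕ), ∃ h, h ^ m ^ k = g)
    (σ : G →* Equiv.Perm X) {g : G} (hfin : {x | σ g x = x}.Finite) {x : X} (hx : σ g x = x)
    (h : G) : σ h x = x := by
  let _ : MulAction G X := MulAction.compHom X σ
  have horbit : (MulAction.orbit G x).Finite := by
    refine hfin.subset ?_
    rintro _ ⟨k, rfl⟩
    change σ g (σ k x) = σ k x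
    rw [← Equiv.Perm.mul_apply, ← map_mul, mul_comm, map_mul, Equiv.Perm.mul_apply, hx]
  have : (MulAction.stabilizer G x).FiniteIndex := ⟨by
    rw [MulAction.index_stabilizer]
    exact (Set.ncard_pos horbit).2 (MulAction.nonempty_orbit x) |>.ne'⟩
  have hmem : h ∈ MulAction.stabilizer G x := by
    rw [subgroup_eq_top_of_finiteIndex m htors hdiv (MulAction.stabilizer G x)]
    trivial
  exact hmem

/-- An action of an `m`-divisible `m`-power torsion abelian group with elements of unbounded order
has no global fixed point if each element agrees with a free action outside a finite set. -/
theorem not_fixed_of_near_free {G X : Type*} [CommGroup G] (m : ℕ) (hm : 0 < m)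
    (htors : ∀ g : G, ∃ k : ℕ, g ^ m ^ k = 1) (hdiv : ∀ (g : G) (k : ℕ), ∃ h, h ^ m ^ k = g)
    (hord : ∀ n : ℕ, ∃ g : G, n < orderOf g)
    (ρ σ : G →* Equiv.Perm X) (hρ : ∀ g x, ρ g x = x → g = 1)
    (hnear : ∀ g, {x | σ g x ≠ ρ g x}.Finite) (x : X) : ¬ ∀ g, σ g x = x := by
  intro hx
  have hfix : ∀ g, g ≠ 1 → {y | σ g y = y}.Finite := fun g hg =>
    (hnear g).subset fun y (hy : σ g y = y) hgy => hg (hρ g y (hgy.symm.trans hy))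
  let T : Set X := {y | ∀ g, σ g y = y}
  have hTfin : T.Finite := by
    obtain ⟨g, hg⟩ := hord 1
    refine (hfix g ?_).subset fun y hy => hy g
    rintro rfl
    simp at hg
  obtain ⟨g, hg⟩ := hord T.ncard
  have : Finite (Subgroup.zpowers g) := by
    obtain ⟨k, hk⟩ := htors g
    exact isOfFinOrder_iff_pow_eq_one.2 ⟨m ^ k, pow_pos hm k, hk⟩ |>.finite_zpowers
  have hdvd := card_dvd_ncard_fixedPoints_of_near_free (ρ.comp (Subgroup.zpowers g).subtype)
    (σ.comp (Subgroup.zpowers g).subtype) (fun h y hy => Subtype.ext (hρ h y hy))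
    (fun h => hnear h) (T := T) fun h hh y =>
      ⟨fun hy => fixed_of_finite_fixedBy m htors hdiv σ
        (hfix h fun h1 => hh (Subtype.ext h1)) hy, fun hy => hy h⟩
  rw [Nat.card_zpowers] at hdvd
  exact hg.not_ge (Nat.le_of_dvd ((Set.ncard_pos hTfin).2 ⟨x, hx⟩) hdvd)

theorem quasiCyclic_torsion (m : ℕ) (g : quasiCyclic m) : ∃ k : ℕ, m ^ k • g = 0 := by
  obtain ⟨k, hk⟩ := g.2
  refine ⟨k, Subtype.ext ?_⟩
  rw [← Nat.cast_pow, natCast_zsmul] at hk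
  exact hk

theorem quasiCyclic_divisible {m : ℕ} (hm : 0 < m) (g : quasiCyclic m) (k : ℕ) :
    ∃ h : quasiCyclic m, m ^ k • h = g := by
  obtain ⟨⟨q⟩, l, hl⟩ := g
  have hq : m ^ k • ((q / (m : ℚ) ^ k : ℚ) : RatModInt) = (q : RatModInt) := by
    rw [← QuotientAddGroup.mk_nsmul, nsmul_eq_mul, Nat.cast_pow, mul_div_cancel₀]
    positivity
  refine ⟨⟨((q / (m : ℚ) ^ k : ℚ) : RatModInt), l + k, ?_⟩, Subtype.ext hq⟩
  rw [pow_add, mul_smul, ← Nat.cast_pow m k, natCast_zsmul, hq]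
  exact hl

theorem exists_lt_addOrderOf_quasiCyclic {m : ℕ} (hm : 2 ≤ m) (n : ℕ) :
    ∃ g : quasiCyclic m, n < addOrderOf g := by
  have hm0 : (0 : ℚ) < m := by positivity
  have hmem : ((1 / (m : ℚ) ^ n : ℚ) : RatModInt) ∈ quasiCyclic m := by
    refine ⟨n, ?_⟩
    rw [← QuotientAddGroup.mk_zsmul, QuotientAddGroup.eq_zero_iff]
    refine ⟨1, ?_⟩
    simp [hm0.ne']
  obtain ⟨k, hk⟩ := quasiCyclic_torsion m ⟨_, hmem⟩
  refine ⟨⟨_, hmem⟩, (Nat.lt_pow_self hm).trans_le ?_⟩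
  set d := addOrderOf (⟨_, hmem⟩ : quasiCyclic m)
  have hdpos : 0 < d :=
    addOrderOf_pos_iff.2 (isOfFinAddOrder_iff_nsmul_eq_zero.2 ⟨m ^ k, by positivity, hk⟩)
  have hzero : d • ((1 / (m : ℚ) ^ n : ℚ) : RatModInt) = 0 :=
    congrArg Subtype.val (addOrderOf_nsmul_eq_zero (⟨_, hmem⟩ : quasiCyclic m))
  rw [← QuotientAddGroup.mk_nsmul, QuotientAddGroup.eq_zero_iff] at hzero
  obtain ⟨z, hz⟩ := AddSubgroup.mem_zmultiples_iff.1 hzero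
  have hdz : (z : ℚ) * (m : ℚ) ^ n = d := by
    rw [zsmul_eq_mul, mul_one, nsmul_eq_mul] at hz
    rw [hz]
    field_simp
  refine Nat.le_of_dvd hdpos (Int.natCast_dvd_natCast.1 ⟨z, ?_⟩)
  have : z * (m : ℤ) ^ n = d := by exact_mod_cast hdz
  push_cast
  rw [← this, mul_comm]

/-- Let `m ≥ 2` and let `X` be a free `C_{m^∞}`-set.  For every nonempty finite subset
`S ⊆ X`, the near action of `C_{m^∞}` on `X ∖ S` is not realizable: no homomorphism
`β` from `C_{m^∞}` to the permutations of `X ∖ S` agrees with the original action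
outside finite sets. -/
theorem quasiCyclic_near_action_on_complement_not_realizable
    (m : ℕ) (hm : 2 ≤ m) (X : Type u) [AddAction ↥(quasiCyclic m) X]
    (hfree : ∀ (g : ↥(quasiCyclic m)) (x : X), g +ᵥ x = x → g = 0)
    (S : Set X) (hSfin : S.Finite) (hSne : S.Nonempty) :
    ¬ ∃ β : ↥(quasiCyclic m) → Equiv.Perm ↥(Sᶜ),
        (∀ g h : ↥(quasiCyclic m), β (g + h) = β g * β h) ∧
        ∀ g : ↥(quasiCyclic m), {x : ↥(Sᶜ) | ((β g x : X)) ≠ g +ᵥ (x : X)}.Finite := by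
  rintro ⟨β, hβ, hnear⟩
  classical
  obtain ⟨s, hs⟩ := hSne
  let ρ : Multiplicative (quasiCyclic m) →* Equiv.Perm X :=
    MulAction.toPermHom (Multiplicative (quasiCyclic m)) X
  let β' : Multiplicative (quasiCyclic m) →* Equiv.Perm ↥(Sᶜ) :=
    MonoidHom.mk' (fun g => β g.toAdd) fun g h => hβ g.toAdd h.toAdd
  let σ : Multiplicative (quasiCyclic m) →* Equiv.Perm X := Equiv.Perm.ofSubtype.comp β'
  refine not_fixed_of_near_free m (by omega) (quasiCyclic_torsion m)
    (quasiCyclic_divisible (by omega)) (exists_lt_addOrderOf_quasiCyclic hm) ρ σ hfree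
    (fun g => ?_) s fun g => Equiv.Perm.ofSubtype_apply_of_not_mem _ (by simpa using hs)
  refine (hSfin.union ((hnear g.toAdd).image Subtype.val)).subset fun x hx => ?_
  by_cases hxS : x ∈ S
  · exact Or.inl hxS
  · refine Or.inr ⟨⟨x, hxS⟩, fun h => hx ?_, rfl⟩
    exact (Equiv.Perm.ofSubtype_apply_of_mem (β' g) hxS).trans h
end

section
/- Let G be a 1-ended group and X a G-set. Let f : G → X be a map such that for every g ∈ G the set {h ∈ G : f(gh) ≠ g·f(h)} is finite. Then there exists a unique y ∈ X such that f(g) = g·y for all but finitely many g ∈ G. -/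
universe u v

/-- A group is 1-ended if it is infinite and every subset `A` such that `gA Δ A` is
finite for every `g` is finite or cofinite. -/
def OneEnded (G : Type u) [Group G] : Prop :=
  Infinite G ∧
    ∀ A : Set G, (∀ g : G, (symmDiff ((g * ·) '' A) A).Finite) → A.Finite ∨ Aᶜ.Finite

/-- A map out of an infinite type all of whose preimages are finite or cofinite is constant
off a finite set. -/
theorem exists_finite_ne_of_preimage_finite_or_cofinite {α : Type u} {β : Type v} [Infinite α]
    (φ : α → β) (h : ∀ B : Set β, (φ ⁻¹' B).Finite ∨ (φ ⁻¹' B)ᶜ.Finite) :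
    ∃ y, {a | φ a ≠ y}.Finite := by
  by_contra! hne
  have fiber_finite (y : β) : (φ ⁻¹' {y}).Finite := (h {y}).resolve_right (hne y)
  have range_infinite : (Set.range φ).Infinite := fun hfin =>
    Set.infinite_univ <| (hfin.preimage' fun y _ => fiber_finite y).subset fun a _ => ⟨a, rfl⟩
  let e := range_infinite.natEmbedding
  choose s hs using fun n => (e n).2
  have s_eq {m n : ℕ} (hmn : φ (s m) = φ (s n)) : m = n :=
    e.injective (Subtype.ext ((hs m).symm.trans (hmn.trans (hs n))))
  have s_injective : Function.Injective s := fun m n hmn => s_eq (congrArg φ hmn)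
  have evens_injective : Function.Injective fun n => s (2 * n) := fun m n hmn => by
    have := s_injective hmn
    omega
  have odds_injective : Function.Injective fun n => s (2 * n + 1) := fun m n hmn => by
    have := s_injective hmn
    omega
  rcases h (Set.range fun n => φ (s (2 * n))) with hfin | hfin
  · exact Set.infinite_range_of_injective evens_injective
      (hfin.subset (Set.range_subset_iff.2 fun n => ⟨n, rfl⟩))
  · refine Set.infinite_range_of_injective odds_injective
      (hfin.subset (Set.range_subset_iff.2 ?_))
    rintro n ⟨m, hm⟩
    have := s_eq hm
    omega

/-- The preimages under an almost invariant map on a 1-ended group are finite or cofinite. -/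
theorem OneEnded.preimage_finite_or_cofinite {G : Type u} [Group G] (hG : OneEnded G)
    {X : Type v} {φ : G → X} (hφ : ∀ g : G, {h : G | φ (g * h) ≠ φ h}.Finite) (B : Set X) :
    (φ ⁻¹' B).Finite ∨ (φ ⁻¹' B)ᶜ.Finite := by
  refine hG.2 _ fun g => (hφ g⁻¹).subset fun x hx heq => ?_
  have mem_iff : x ∈ (g * ·) '' (φ ⁻¹' B) ↔ x ∈ φ ⁻¹' B := by
    rw [Set.image_mul_left, Set.mem_preimage, Set.mem_preimage, Set.mem_preimage, heq]
  rw [Set.mem_symmDiff, mem_iff] at hx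
  tauto

/-- Let `G` be a 1-ended group and `X` a `G`-set.  If `f : G → X` is closely equivariant
(for every `g`, `f (g h) = g • f h` for all but finitely many `h`), then there is a
unique `y ∈ X` such that `f g = g • y` for all but finitely many `g`. -/
theorem closely_equivariant_map_near_equals_orbit_map
    {G : Type u} [Group G] (hG : OneEnded G)
    {X : Type v} [MulAction G X] (f : G → X)
    (hf : ∀ g : G, {h : G | f (g * h) ≠ g • f h}.Finite) :
    ∃! y : X, {g : G | f g ≠ g • y}.Finite := by
  have : Infinite G := hG.1
  have ne_iff (g : G) (y : X) : f g ≠ g • y ↔ g⁻¹ • f g ≠ y := by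
    rw [Ne, Ne, inv_smul_eq_iff]
  simp only [ne_iff]
  have almost_invariant (g : G) : {h : G | (g * h)⁻¹ • f (g * h) ≠ h⁻¹ • f h}.Finite := by
    refine (hf g).subset fun h hne heq => hne ?_
    rw [heq, mul_inv_rev, mul_smul, inv_smul_smul]
  obtain ⟨y, hy⟩ := exists_finite_ne_of_preimage_finite_or_cofinite (fun g => g⁻¹ • f g)
    (hG.preimage_finite_or_cofinite almost_invariant)
  refine ⟨y, hy, fun z hz => ?_⟩
  obtain ⟨g, hg⟩ := (hz.union hy).exists_notMem
  simp only [Set.mem_union, Set.mem_ofPred_eq, not_or, not_not] at hg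
  exact hg.1.symm.trans hg.2
end

section
/- Let G be a 1-ended group that is not locally finite. Let X be a G-set, given by a homomorphism α : G → Perm(X), in which the stabilizer of every point of X is finite (e.g., the action is free). Let β : G → Perm(X) be a group homomorphism such that α(g)⁻¹β(g) is finitely supported for every g ∈ G (a finite perturbation of α). Then there exists a unique finitely supported permutation τ of X such that β(g) = τ ∘ α(g) ∘ τ⁻¹ for all g ∈ G. -/
universe u v

open Filter

/-- A function on a 1-ended group that is almost invariant under left translations is constant
outside a finite set. -/
theorem OneEnded.exists_eventually_eq {G : Type u} [Group G] (hG : OneEnded G) {Y : Type v}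
    (φ : G → Y) (hφ : ∀ h : G, ∀ᶠ g in cofinite, φ (h * g) = φ g) :
    ∃ y, ∀ᶠ g in cofinite, φ g = y := by
  obtain ⟨hinf, hG⟩ := hG
  have key : ∀ B : Set Y, (φ ⁻¹' B).Finite ∨ (φ ⁻¹' B)ᶜ.Finite := by
    refine fun B => hG _ fun h => (hφ h⁻¹).subset ?_
    intro g hg heq
    have hmem : g ∈ (h * ·) '' (φ ⁻¹' B) ↔ φ (h⁻¹ * g) ∈ B := by
      rw [Set.image_mul_left]; rfl
    rw [Set.mem_symmDiff, hmem, heq] at hg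
    simp at hg
  by_contra hcon
  have hfib : ∀ y, (φ ⁻¹' {y}).Finite := fun y =>
    (key {y}).resolve_right fun h => hcon ⟨y, h⟩
  have hrange : (Set.range φ).Infinite := by
    intro hfin
    have : (Set.univ : Set G).Finite := by
      rw [← Set.preimage_range φ]
      exact hfin.preimage' fun y _ => hfib y
    exact Set.infinite_univ this
  obtain ⟨B, C, hBC, hdisj, hcard⟩ := hrange.exists_union_disjoint_cardinal_eq_of_infinite
  have hiff : B.Infinite ↔ C.Infinite := by
    rw [← Set.infinite_coe_iff, ← Set.infinite_coe_iff, Cardinal.infinite_iff, hcard,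
      Cardinal.infinite_iff]
  have hor : B.Infinite ∨ C.Infinite := Set.infinite_union.mp (hBC ▸ hrange)
  have hB : B.Infinite := hor.elim id hiff.mpr
  have hC : C.Infinite := hiff.mp hB
  rcases key B with h | h
  · exact (hB.preimage (hBC ▸ Set.subset_union_left)) h
  · exact (hC.preimage (hBC ▸ Set.subset_union_right))
      (h.subset fun g hg hg' => Set.disjoint_left.mp hdisj hg' hg)

/-- An injective self-map moving only finitely many points is surjective. -/
theorem Function.Injective.surjective_of_finite_support {X : Type*} {f : X → X}
    (hf : Function.Injective f) (hfin : {x | f x ≠ x}.Finite) : Function.Surjective f := by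
  intro y
  by_cases hy : f y = y
  · exact ⟨y, hy⟩
  have hmaps : Set.MapsTo f {x | f x ≠ x} {x | f x ≠ x} := fun x hx h => hx (hf h)
  have := hfin.to_subtype
  obtain ⟨x, hx⟩ := Finite.surjective_of_injective
    (hmaps.restrict_inj.mpr hf.injOn) ⟨y, hy⟩
  exact ⟨x, congrArg Subtype.val hx⟩

section Perturbation

variable {G : Type u} [Group G] {X : Type v} {α β : G →* Equiv.Perm X}

theorem eventually_apply_notMem_of_finite_stabilizer
    (hstab : ∀ x : X, {g : G | α g x = x}.Finite) (x : X) {D : Set X} (hD : D.Finite) :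
    ∀ᶠ g in cofinite, α g x ∉ D := by
  have : ((fun g => α g x) ⁻¹' D).Finite := by
    refine hD.preimage' fun y _ => ?_
    by_cases hy : ∃ k, α k x = y
    · obtain ⟨k, rfl⟩ := hy
      refine ((hstab x).image (k * ·)).subset fun g hg => ⟨k⁻¹ * g, ?_, by simp⟩
      have hg : α g x = α k x := hg
      simp [hg]
    · convert Set.finite_empty
      exact Set.eq_empty_of_forall_notMem fun g hg => hy ⟨g, hg⟩
  simpa [Filter.Eventually, mem_cofinite, Set.compl_def, Set.preimage] using this

/-- The limit of `(β g)⁻¹ (α g x)` along the cofinite filter exists. -/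
theorem exists_eventually_inv_apply_eq (hG : OneEnded G)
    (hstab : ∀ x : X, {g : G | α g x = x}.Finite)
    (hpert : ∀ g : G, {x : X | β g x ≠ α g x}.Finite) (x : X) :
    ∃ y, ∀ᶠ g in cofinite, (β g)⁻¹ (α g x) = y := by
  refine hG.exists_eventually_eq _ fun h => ?_
  filter_upwards [eventually_apply_notMem_of_finite_stabilizer hstab x (hpert h)] with g hg
  have hg : β h (α g x) = α h (α g x) := by simpa using hg
  simp [← hg]

/-- If the `α`-orbit of `x` under the subgroup generated by `S` avoids the points where `α` and
`β` differ on `S`, then `α` and `β` agree at `x` on that subgroup. -/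
theorem apply_eq_of_forall_mem_closure {S : Set G} {x : X}
    (hx : ∀ k ∈ Subgroup.closure S, ∀ s ∈ S, β s (α k x) = α s (α k x)) {h : G}
    (hh : h ∈ Subgroup.closure S) : β h x = α h x := by
  suffices H : ∀ k ∈ Subgroup.closure S, β h (α k x) = α h (α k x) by
    simpa using H 1 (one_mem _)
  induction hh using Subgroup.closure_induction with
  | mem s hs => exact fun k hk => hx k hk s hs
  | one => simp
  | mul a b ha hb iha ihb =>
    intro k hk
    have := iha (b * k) (mul_mem hb hk)
    simp only [map_mul, Equiv.Perm.mul_apply] at this ⊢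
    rw [ihb k hk, this]
  | inv a ha iha =>
    intro k hk
    have := iha (a⁻¹ * k) (mul_mem (inv_mem ha) hk)
    simp only [map_mul, map_inv, Equiv.Perm.mul_apply] at this ⊢
    rw [Equiv.Perm.inv_eq_iff_eq, this]
    simp

end Perturbation

/-- Let `G` be a 1-ended group that is not locally finite, and let `α` be an action of `G`
on `X` with finite point stabilizers.  Then every finite perturbation `β` of `α` is
conjugate to `α` by a unique finitely supported permutation. -/
theorem finite_perturbation_conjugate_by_finitely_supported_perm
    {G : Type u} [Group G] (hG : OneEnded G)
    (hnlf : ¬ ∀ H : Subgroup G, H.FG → Finite H)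
    {X : Type v} (α β : G →* Equiv.Perm X)
    (hstab : ∀ x : X, {g : G | α g x = x}.Finite)
    (hpert : ∀ g : G, {x : X | β g x ≠ α g x}.Finite) :
    ∃! τ : Equiv.Perm X, {x : X | τ x ≠ x}.Finite ∧ ∀ g : G, β g = τ * α g * τ⁻¹ := by
  have := hG.1
  choose t ht using exists_eventually_inv_apply_eq hG hstab hpert
  have hinj : Function.Injective t := by
    intro x x' hxx
    obtain ⟨g, hg, hg'⟩ := ((ht x).and (ht x')).exists
    exact (α g).injective ((β g)⁻¹.injective (by rw [hg, hg', hxx]))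
  have heq : ∀ h x, t (α h x) = β h (t x) := by
    intro h x
    have hx := (mul_left_injective h).tendsto_cofinite.eventually (ht x)
    obtain ⟨g, hg, hg'⟩ := ((ht (α h x)).and hx).exists
    rw [← hg, ← hg']
    simp
  have hfix : ∀ x, {h | t (α h x) ≠ α h x}.Finite := by
    intro x
    refine Set.Finite.subset (ht x) fun h hh hh' => hh ?_
    rw [heq, ← hh']
    simp
  have hsupp : {x | t x ≠ x}.Finite := by
    push Not at hnlf
    obtain ⟨H, ⟨S, rfl⟩, hH⟩ := hnlf
    have hHinf : (Subgroup.closure (S : Set G) : Set G).Infinite :=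
      Set.infinite_coe_iff.mp (by simpa using hH)
    have hF : (⋃ s ∈ S, {x | β s x ≠ α s x}).Finite :=
      S.finite_toSet.biUnion fun s _ => hpert s
    refine (hF.biUnion fun f _ => (hfix f).image fun h => α h f).subset fun x hx => ?_
    by_cases hx' : ∀ k ∈ Subgroup.closure (S : Set G), ∀ s ∈ (S : Set G),
        β s (α k x) = α s (α k x)
    · obtain ⟨h, hh, hxh⟩ := (hHinf.frequently_cofinite.and_eventually (ht x)).exists
      rw [← apply_eq_of_forall_mem_closure hx' hh] at hxh
      exact absurd (by simpa using hxh.symm) hx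
    · push Not at hx'
      obtain ⟨k, -, s, hs, hne⟩ := hx'
      refine Set.mem_biUnion (Set.mem_biUnion hs hne) ⟨k⁻¹, ?_, by simp⟩
      simpa using hx
  refine ⟨Equiv.ofBijective t ⟨hinj, hinj.surjective_of_finite_support hsupp⟩, ⟨hsupp, ?_⟩, ?_⟩
  · intro g
    rw [eq_mul_inv_iff_mul_eq]
    ext x
    exact (heq g x).symm
  · rintro σ ⟨hσ, hσc⟩
    have hσeq : ∀ h x, σ (α h x) = β h (σ x) := fun h x => by simp [hσc]
    ext x
    have h1 := eventually_apply_notMem_of_finite_stabilizer hstab x hσ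
    have h2 := eventually_apply_notMem_of_finite_stabilizer hstab x hsupp
    obtain ⟨h, h1, h2⟩ := (h1.and h2).exists
    have h1 : σ (α h x) = α h x := by simpa using h1
    have h2 : t (α h x) = α h x := by simpa using h2
    refine (β h).injective (?_ : β h (σ x) = β h (t x))
    rw [← hσeq, h1, ← heq, h2]
end

section
/- Let G be a 1-ended group, H a finite subgroup of G, and F a nonempty finite subset of the coset space G/H. Then the near action of G on (G/H) ∖ F is not realizable: there is no group homomorphism β : G → Perm((G/H) ∖ F) such that for every g ∈ G, β(g)(x) = g·x for all but finitely many x ∈ (G/H) ∖ F (where g·(kH) = gkH is the left translation action of G on G/H). -/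
universe u v

/-- A function on a 1-ended group that is almost invariant under left translations is constant
outside a finite set. -/
theorem OneEnded.exists_finite_ne_of_almost_invariant {G : Type u} [Group G] (hG : OneEnded G)
    {X : Type v} (φ : G → X) (hφ : ∀ h : G, {g | φ (h * g) ≠ φ g}.Finite) :
    ∃ x, {g | φ g ≠ x}.Finite := by
  have := hG.1
  have dichotomy (S : Set X) : (φ ⁻¹' S).Finite ∨ (φ ⁻¹' S)ᶜ.Finite := by
    refine hG.2 _ fun h => (hφ h⁻¹).subset ?_
    rintro g (⟨⟨a, ha, rfl⟩, hg⟩ | ⟨hg, hga⟩) heq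
    · apply hg
      simp only [inv_mul_cancel_left, Set.mem_preimage] at heq ha ⊢
      rwa [← heq]
    · refine hga ⟨h⁻¹ * g, ?_, by simp⟩
      rw [Set.mem_preimage, heq]
      exact hg
  by_contra! hne
  have fiber (x : X) : (φ ⁻¹' {x}).Finite := (dichotomy {x}).resolve_right (hne x)
  have hrange : (Set.range φ).Infinite := fun hfin =>
    Set.infinite_univ <| (hfin.preimage' fun x _ => fiber x).subset fun g _ => ⟨g, rfl⟩
  let f := hrange.natEmbedding
  choose e he using fun n => (f n).2
  have hinj : Function.Injective fun n => φ (e n) := fun m n hmn =>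
    f.injective <| Subtype.ext <| by simpa only [he] using hmn
  have hinj' : Function.Injective e := fun m n hmn => hinj (congrArg φ hmn)
  rcases dichotomy (Set.range fun n => φ (e (2 * n))) with h | h
  · refine Set.infinite_range_of_injective (f := fun n => e (2 * n)) ?_ (h.subset ?_)
    · intro m n hmn
      have := hinj' hmn
      lia
    · rintro _ ⟨n, rfl⟩
      exact ⟨n, rfl⟩
  · refine Set.infinite_range_of_injective (f := fun n => e (2 * n + 1)) ?_ (h.subset ?_)
    · intro m n hmn
      have := hinj' hmn
      lia
    · rintro _ ⟨n, rfl⟩ ⟨m, hm⟩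
      have := hinj hm
      lia

/-- The preimage in `G` of a finite set of cosets of a finite subgroup is finite. -/
theorem Set.Finite.preimage_quotientGroup_mk {G : Type u} [Group G] {H : Subgroup G} [Finite H]
    {T : Set (G ⧸ H)} (hT : T.Finite) : {g : G | (g : G ⧸ H) ∈ T}.Finite := by
  refine hT.preimage' fun b _ => ?_
  obtain ⟨b, rfl⟩ := QuotientGroup.mk_surjective b
  refine (Set.finite_range fun h : H => b * h).subset fun g hg => ?_
  exact ⟨⟨b⁻¹ * g, QuotientGroup.eq.1 (Eq.symm hg)⟩, by simp⟩

/-- An injective self-map that fixes all but finitely many points is surjective. -/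
theorem Function.Injective.surjective_of_finite_ne {X : Type u} {ψ : X → X}
    (hψ : Function.Injective ψ) (hfin : {x | ψ x ≠ x}.Finite) : Function.Surjective ψ := by
  have hmaps : Set.MapsTo ψ {x | ψ x ≠ x} {x | ψ x ≠ x} := fun x hx h => hx (hψ h)
  have : Finite {x | ψ x ≠ x} := hfin
  have hsurj := Finite.surjective_of_injective (hmaps.restrict_inj.2 hψ.injOn)
  intro y
  by_cases hy : ψ y = y
  · exact ⟨y, hy⟩
  · obtain ⟨x, hx⟩ := hsurj ⟨y, hy⟩
    exact ⟨x, congrArg Subtype.val hx⟩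

/-- If a homomorphism to permutations of a cofinite subset of `G ⧸ H` is near left translation,
then off a finite set the translation orbit map of `G` agrees with one of its orbit maps. -/
theorem OneEnded.exists_finite_orbit_ne {G : Type u} [Group G] (hG : OneEnded G)
    {H : Subgroup G} [Finite H] {F : Set (G ⧸ H)} (hF : F.Finite) (β : G →* Equiv.Perm ↥(Fᶜ))
    (hβ : ∀ g : G, {x : ↥(Fᶜ) | ((β g x : G ⧸ H)) ≠ g • (x : G ⧸ H)}.Finite) :
    ∃ x : ↥(Fᶜ), {g : G | (β g x : G ⧸ H) ≠ (g : G ⧸ H)}.Finite := by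
  classical
  have := hG.1
  have hFpre := hF.preimage_quotientGroup_mk
  obtain ⟨g₀, hg₀⟩ := hFpre.exists_notMem
  let φ : G → ↥(Fᶜ) := fun g => if h : (g : G ⧸ H) ∈ Fᶜ then (β g)⁻¹ ⟨g, h⟩ else ⟨g₀, hg₀⟩
  have φ_spec (g : G) (h : (g : G ⧸ H) ∈ Fᶜ) : β g (φ g) = ⟨g, h⟩ := by
    simp only [φ, dif_pos h, ← Equiv.Perm.mul_apply, mul_inv_cancel, Equiv.Perm.one_apply]
  obtain ⟨x, hx⟩ := hG.exists_finite_ne_of_almost_invariant φ fun h => by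
    have hbad := ((hβ h).image Subtype.val).preimage_quotientGroup_mk
    have hshift : {g : G | ((h * g : G) : G ⧸ H) ∈ F}.Finite :=
      Set.Finite.preimage (f := (h * ·)) (mul_right_injective h).injOn hFpre
    refine ((hFpre.union hshift).union hbad).subset fun g hg => ?_
    by_contra hcon
    simp only [Set.mem_union, not_or] at hcon
    obtain ⟨⟨h1, h2⟩, h3⟩ := hcon
    refine hg ((β (h * g)).injective ?_)
    rw [φ_spec (h * g) h2, map_mul, Equiv.Perm.mul_apply, φ_spec g h1]
    by_contra hne
    exact h3 ⟨⟨g, h1⟩, fun heq => hne (Subtype.ext heq.symm), rfl⟩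
  refine ⟨x, (hFpre.union hx).subset fun g hg => ?_⟩
  by_contra hcon
  simp only [Set.mem_union, not_or] at hcon
  obtain ⟨h1, h2⟩ := hcon
  have h2 : φ g = x := not_not.1 h2
  exact hg (by rw [← h2, φ_spec g h1])

/-- Let `G` be a 1-ended group, `H` a finite subgroup and `F` a nonempty finite subset of
the coset space `G/H`.  Then the near action of `G` on `(G/H) ∖ F` is not realizable:
there is no homomorphism `β : G →* Perm ((G/H) ∖ F)` agreeing, for each `g`, with left
translation by `g` outside a finite set. -/
theorem near_action_on_coset_space_minus_finite_set_not_realizable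
    {G : Type u} [Group G] (hG : OneEnded G)
    (H : Subgroup G) [Finite H]
    (F : Set (G ⧸ H)) (hFfin : F.Finite) (hFne : F.Nonempty) :
    ¬ ∃ β : G →* Equiv.Perm ↥(Fᶜ),
        ∀ g : G, {x : ↥(Fᶜ) | ((β g x : G ⧸ H)) ≠ g • (x : G ⧸ H)}.Finite := by
  rintro ⟨β, hβ⟩
  have := hG.1
  obtain ⟨x, hx⟩ := hG.exists_finite_orbit_ne hFfin β hβ
  have stabilizer (k : G) : β k x = x ↔ k ∈ H := by
    have hshift : {g : G | (β (g * k) x : G ⧸ H) ≠ ((g * k : G) : G ⧸ H)}.Finite :=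
      Set.Finite.preimage (f := (· * k)) (mul_left_injective k).injOn hx
    obtain ⟨g, hg⟩ := (hx.union hshift).exists_notMem
    simp only [Set.mem_union, Set.mem_ofPred_eq, not_or, not_not] at hg
    obtain ⟨h1, h2⟩ := hg
    rw [← (β g).injective.eq_iff, ← Equiv.Perm.mul_apply, ← map_mul, Subtype.ext_iff, h1, h2,
      eq_comm, QuotientGroup.eq, inv_mul_cancel_left]
  have orbit_eq (a b : G) : β a x = β b x ↔ (a : G ⧸ H) = (b : G ⧸ H) := by
    rw [QuotientGroup.eq, ← stabilizer, map_mul, map_inv, Equiv.Perm.mul_apply,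
      Equiv.Perm.inv_eq_iff_eq, eq_comm]
  let ψ : G ⧸ H → G ⧸ H := fun y => β y.out x
  have ψ_mk (g : G) : ψ g = β g x :=
    congrArg Subtype.val <| (orbit_eq _ _).2 (QuotientGroup.out_eq' _)
  have ψ_inj : Function.Injective ψ := fun a b hab => by
    simpa only [QuotientGroup.out_eq'] using (orbit_eq _ _).1 (Subtype.ext hab)
  have ψ_fin : {y | ψ y ≠ y}.Finite := by
    refine (hx.image (QuotientGroup.mk (s := H))).subset fun y hy => ?_
    obtain ⟨g, rfl⟩ := QuotientGroup.mk_surjective y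
    exact ⟨g, fun h => hy ((ψ_mk g).trans h), rfl⟩
  obtain ⟨y, hy⟩ := hFne
  obtain ⟨z, rfl⟩ := ψ_inj.surjective_of_finite_ne ψ_fin y
  exact (β z.out x).2 hy
end

section
/- Let G be a finitely generated virtually abelian group (i.e., G has an abelian subgroup of finite index), X a set, and α : G → S⋆(X) a near action of finite type: there exist a finite generating subset S of G and, for each s ∈ S, a representative σ_s of α(s), such that the graph with vertex set X and edge set {{x, σ_s(x)} : s ∈ S, x ∈ dom(σ_s)} has only finitely many connected components. Then X is finitely-ended: the set of α-commensurated subsets of X, modulo the equivalence relation identifying two subsets whose symmetric difference is finite, is finite. -/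
open Set

universe u v w

variable {X : Type u}

/-- A near action `α : G →* NearPerm X` of a finitely generated group is of finite type
if some (equivalently, any) near Schreier graph has finitely many connected
components. -/
def FiniteType {G : Type w} [Group G] {X : Type u} (α : G →* NearPerm X) : Prop :=
  ∃ (S : Finset G) (σ : G → PartialEquiv X X) (hσ : ∀ s ∈ S, IsCofinBij (σ s)),
    Subgroup.closure (S : Set G) = ⊤ ∧
    (∀ s (hs : s ∈ S), NearPerm.mk (σ s) (hσ s hs) = α s) ∧
    Finite (Quotient (graphSetoid (S : Set G) σ))

/-- A subset `A ⊆ X` is commensurated by the near action `α` if, for every `g` and every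
representative `e` of `α g`, the symmetric difference `e (A ∩ dom e) Δ A` is finite. -/
def Commensurated {G : Type w} [Group G] {X : Type u} (α : G →* NearPerm X)
    (A : Set X) : Prop :=
  ∀ (g : G) (e : PartialEquiv X X) (he : IsCofinBij e),
    NearPerm.mk e he = α g → (symmDiff (⇑e '' (A ∩ e.source)) A).Finite

/-! ### Well-quasi-orders are finite unions of directed sets -/

theorem wellFoundedLT_lowerSet {Y : Type*} [Preorder Y] [WellQuasiOrderedLE Y] :
    WellFoundedLT (LowerSet Y) := by
  rw [WellFoundedLT, isWellFounded_iff, RelEmbedding.wellFounded_iff_isEmpty]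
  refine ⟨fun D => ?_⟩
  have hlt : ∀ {m n : ℕ}, m < n → D n < D m := fun h => D.map_rel_iff.2 h
  have hx : ∀ n, ∃ x, x ∈ D n ∧ x ∉ D (n + 1) := fun n =>
    Set.exists_of_ssubset (LowerSet.coe_ssubset_coe.2 (hlt n.lt_succ_self))
  choose x hxmem hxnot using hx
  obtain ⟨m, n, hmn, hle⟩ := wellQuasiOrdered_le x
  have hsub : D n ≤ D (m + 1) := by
    rcases (Nat.succ_le_of_lt hmn).eq_or_lt with h | h
    · exact le_of_eq (congrArg D h.symm)
    · exact (hlt h).le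
  exact hxnot m ((D (m + 1)).lower hle (hsub (hxmem n)))

theorem directedOn_of_supIrred {Y : Type*} [Preorder Y] {I : LowerSet Y} (hI : SupIrred I) :
    DirectedOn (· ≤ ·) (I : Set Y) := by
  intro x hx y hy
  by_contra! hxy
  let avoid (a : Y) : LowerSet Y :=
    ⟨{z | z ∈ I ∧ ¬ a ≤ z}, fun _ _ hba ha => ⟨I.lower hba ha.1, fun h => ha.2 (h.trans hba)⟩⟩
  have hsup : avoid x ⊔ avoid y = I := by
    refine SetLike.ext fun z => ⟨?_, fun hz => ?_⟩
    · rintro (h | h) <;> exact h.1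
    · by_cases hxz : x ≤ z
      · exact Or.inr ⟨hz, hxy z hz hxz⟩
      · exact Or.inl ⟨hz, hxz⟩
  rcases hI.2 hsup with h | h
  · have : x ∈ avoid x := h ▸ hx
    exact this.2 le_rfl
  · have : y ∈ avoid y := h ▸ hy
    exact this.2 le_rfl

theorem exists_finset_directedOn_cover (Y : Type*) [Preorder Y] [WellQuasiOrderedLE Y] :
    ∃ 𝓘 : Finset (LowerSet Y), (∀ I ∈ 𝓘, DirectedOn (· ≤ ·) (I : Set Y)) ∧
      ∀ x, ∃ I ∈ 𝓘, x ∈ I := by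
  have := wellFoundedLT_lowerSet (Y := Y)
  obtain ⟨𝓘, hsup, hirr⟩ := exists_supIrred_decomposition (⊤ : LowerSet Y)
  refine ⟨𝓘, fun I hI => directedOn_of_supIrred (hirr hI), fun x => ?_⟩
  have hx : x ∈ 𝓘.sup id := hsup ▸ LowerSet.mem_top
  rw [Finset.sup_eq_iSup] at hx
  simpa using hx

/-! ### Level functions and almost commuting families of maps -/

section Level

variable {ι : Type*} {f : ι → X → X} {lev : X → ℕ} {N : ℕ}

/-- Apply the letters of a word successively, from left to right. -/
def runWord (f : ι → X → X) (w : List ι) (x : X) : X := w.foldl (fun y e => f e y) x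

theorem runWord_cons (e : ι) (w : List ι) (x : X) :
    runWord f (e :: w) x = runWord f w (f e x) := rfl

theorem runWord_append (w w' : List ι) (x : X) :
    runWord f (w ++ w') x = runWord f w' (runWord f w x) := List.foldl_append

theorem lev_runWord_le (hlip : ∀ e x, lev (f e x) ≤ lev x + 1) (w : List ι) (x : X) :
    lev (runWord f w x) ≤ lev x + w.length := by
  induction w generalizing x with
  | nil => exact le_rfl
  | cons e w ih =>
    have h1 := ih (f e x)
    have h2 := hlip e x
    rw [runWord_cons, List.length_cons]
    omega

/-- The word `w` raises the level by one at each step when started at `x`. -/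
def Ascends (f : ι → X → X) (lev : X → ℕ) (w : List ι) (x : X) : Prop :=
  lev (runWord f w x) = lev x + w.length

theorem ascends_append (hlip : ∀ e x, lev (f e x) ≤ lev x + 1) {w w' : List ι} {x : X} :
    Ascends f lev (w ++ w') x ↔ Ascends f lev w x ∧ Ascends f lev w' (runWord f w x) := by
  have h1 := lev_runWord_le hlip w x
  have h2 := lev_runWord_le hlip w' (runWord f w x)
  unfold Ascends
  rw [runWord_append, List.length_append]
  omega

theorem ascends_cons (hlip : ∀ e x, lev (f e x) ≤ lev x + 1) {e : ι} {w : List ι} {x : X} :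
    Ascends f lev (e :: w) x ↔ lev (f e x) = lev x + 1 ∧ Ascends f lev w (f e x) :=
  ascends_append hlip (w := [e])

theorem runWord_perm (hlip : ∀ e x, lev (f e x) ≤ lev x + 1)
    (hcomm : ∀ x, N ≤ lev x → ∀ a b, f a (f b x) = f b (f a x))
    {w w' : List ι} (hw : w.Perm w') {x : X} (hx : N ≤ lev x) (hasc : Ascends f lev w x) :
    runWord f w' x = runWord f w x := by
  induction hw generalizing x with
  | nil => rfl
  | cons e _ ih =>
    rw [ascends_cons hlip] at hasc
    exact ih (x := f e x) (by omega) hasc.2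
  | swap a b w =>
    rw [runWord_cons, runWord_cons, runWord_cons, runWord_cons, hcomm x hx]
  | trans h₁ h₂ ih₁ ih₂ =>
    have h := ih₁ hx hasc
    rw [ih₂ hx (by unfold Ascends at hasc ⊢; rw [h, hasc, h₁.length_eq]), h]

/-- The preorder in which `x ≤ y` when `y` is reached from `x` by an ascending word. -/
@[reducible]
def ascentPreorder (hlip : ∀ e x, lev (f e x) ≤ lev x + 1) : Preorder X where
  le x y := ∃ w, Ascends f lev w x ∧ runWord f w x = y
  le_refl x := ⟨[], rfl, rfl⟩
  le_trans := by
    rintro x _ _ ⟨w, hw, rfl⟩ ⟨w', hw', rfl⟩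
    exact ⟨w ++ w', (ascends_append hlip).2 ⟨hw, hw'⟩, runWord_append w w' x⟩

theorem exists_ascends_from_level
    (hpred : ∀ x, N < lev x → ∃ e z, lev z + 1 = lev x ∧ f e z = x) (x : X) (hx : N ≤ lev x) :
    ∃ b w, lev b = N ∧ Ascends f lev w b ∧ runWord f w b = x := by
  obtain ⟨n, hn⟩ := Nat.exists_eq_add_of_le hx
  induction n generalizing x with
  | zero => exact ⟨x, [], hn, rfl, rfl⟩
  | succ n ih =>
    obtain ⟨e, z, hz, rfl⟩ := hpred x (by omega)
    obtain ⟨b, w, hb, hw, rfl⟩ := ih z (by omega) (by omega)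
    refine ⟨b, w ++ [e], hb, ?_, runWord_append w [e] b⟩
    unfold Ascends at hw ⊢
    rw [runWord_append, List.length_append, List.length_singleton]
    change lev (f e (runWord f w b)) = _
    omega

theorem ascentPreorder_wellQuasiOrderedLE [Finite ι] (hfin : ∀ n, {x | lev x ≤ n}.Finite)
    (hlip : ∀ e x, lev (f e x) ≤ lev x + 1)
    (hcomm : ∀ x, N ≤ lev x → ∀ a b, f a (f b x) = f b (f a x))
    (hpred : ∀ x, N < lev x → ∃ e z, lev z + 1 = lev x ∧ f e z = x) :
    @WellQuasiOrderedLE X (ascentPreorder hlip).toLE := by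
  classical
  let := ascentPreorder hlip
  have hbase : ∀ x, ∃ b w, lev b ≤ N ∧ (lev b = N ∨ x = b) ∧ Ascends f lev w b ∧
      runWord f w b = x := by
    intro x
    rcases le_total N (lev x) with h | h
    · obtain ⟨b, w, hb, hw⟩ := exists_ascends_from_level hpred x h
      exact ⟨b, w, hb.le, Or.inl hb, hw⟩
    · exact ⟨x, [], h, Or.inr rfl, rfl, rfl⟩
  choose b w hbN hb hasc hrun using hbase
  have : Finite {x | lev x ≤ N} := hfin N
  refine ⟨fun u => ?_⟩
  obtain ⟨m, n, hmn, hbase, hcount⟩ :=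
    (Finite.wellQuasiOrdered (α := {x | lev x ≤ N}) (· = ·)).prod
      (wellQuasiOrdered_le (α := ι → ℕ))
      (fun k => (⟨b (u k), hbN (u k)⟩, fun e => (w (u k)).count e))
  refine ⟨m, n, hmn, ?_⟩
  have hbb : b (u m) = b (u n) := congrArg Subtype.val hbase
  rcases hb (u m) with hm | hm
  · have hsub : (w (u m)).Subperm (w (u n)) := List.subperm_iff_count.2 hcount
    obtain ⟨l, hl, hlw⟩ := hsub
    obtain ⟨r, hlr⟩ := hlw.exists_perm_append
    have hr := hlr.trans (hl.append_right r)
    have hn := hasc (u n)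
    rw [← hbb] at hn
    have hperm := runWord_perm hlip hcomm hr hm.ge hn
    have hlevel : Ascends f lev (w (u m) ++ r) (b (u m)) := by
      unfold Ascends at hn ⊢
      rw [hperm, hn, hr.length_eq]
    have hfinal := ((ascends_append hlip).1 hlevel).2
    rw [hrun] at hfinal
    refine ⟨r, hfinal, ?_⟩
    rw [runWord_append, hrun, hbb, hrun] at hperm
    exact hperm
  · refine ⟨w (u n), ?_, ?_⟩
    · rw [hm, hbb]; exact hasc _
    · rw [hm, hbb]; exact hrun _

theorem mem_runWord_iff (hlip : ∀ e x, lev (f e x) ≤ lev x + 1) {A : Set X} {M : ℕ}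
    (hA : ∀ x, M ≤ lev x → ∀ e, (f e x ∈ A ↔ x ∈ A)) (w : List ι) {x : X} (hx : M ≤ lev x)
    (hasc : Ascends f lev w x) : runWord f w x ∈ A ↔ x ∈ A := by
  induction w generalizing x with
  | nil => rfl
  | cons e w ih =>
    rw [ascends_cons hlip] at hasc
    rw [runWord_cons, ih (by omega) hasc.2, hA x hx e]

theorem exists_level_bound (lev : X → ℕ) {B : Set X} (hB : B.Finite) :
    ∃ M, ∀ x, M ≤ lev x → x ∉ B := by
  obtain ⟨M, hM⟩ := (hB.image lev).bddAbove
  refine ⟨M + 1, fun x hx hxB => ?_⟩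
  have := hM (mem_image_of_mem lev hxB)
  omega

theorem exists_finset_of_almost_invariant [Finite ι] (hfin : ∀ n, {x | lev x ≤ n}.Finite)
    (hlip : ∀ e x, lev (f e x) ≤ lev x + 1)
    (hcomm : ∀ x, N ≤ lev x → ∀ a b, f a (f b x) = f b (f a x))
    (hpred : ∀ x, N < lev x → ∃ e z, lev z + 1 = lev x ∧ f e z = x) :
    ∃ 𝒜 : Finset (Set X), ∀ A : Set X, (∀ e, {x | ¬ (f e x ∈ A ↔ x ∈ A)}.Finite) →
      ∃ B ∈ 𝒜, (symmDiff A B).Finite := by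
  classical
  let := ascentPreorder hlip
  have := ascentPreorder_wellQuasiOrderedLE hfin hlip hcomm hpred
  obtain ⟨𝓘, hdir, hcover⟩ := exists_finset_directedOn_cover X
  refine ⟨𝓘.powerset.image fun J : Finset (LowerSet X) => ⋃ I ∈ J, (I : Set X),
    fun A hA => ?_⟩
  obtain ⟨M, hM⟩ := exists_level_bound lev (Set.finite_iUnion hA)
  have hinv : ∀ x, M ≤ lev x → ∀ e, (f e x ∈ A ↔ x ∈ A) := fun x hx e => by
    by_contra h
    exact hM x hx (mem_iUnion_of_mem e h)
  have hdeep : ∀ B : Set X, B.Infinite → ∃ x ∈ B, M ≤ lev x := fun B hB => by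
    obtain ⟨x, hxB, hx⟩ := hB.exists_notMem_finite (hfin M)
    exact ⟨x, hxB, (not_le.1 hx).le⟩
  have hdich : ∀ I ∈ 𝓘, ((I : Set X) ∩ A).Infinite → ((I : Set X) \ A).Finite := by
    intro I hI h₁
    by_contra h₂
    obtain ⟨x, ⟨hxI, hxA⟩, hx⟩ := hdeep _ h₁
    obtain ⟨y, ⟨hyI, hyA⟩, hy⟩ := hdeep _ h₂
    obtain ⟨z, -, ⟨w, hw, hwz⟩, w', hw', hwz'⟩ := hdir I hI x hxI y hyI
    have hzx := mem_runWord_iff hlip hinv w hx hw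
    have hzy := mem_runWord_iff hlip hinv w' hy hw'
    rw [hwz] at hzx
    rw [hwz'] at hzy
    exact hyA (hzy.1 (hzx.2 hxA))
  let J : Finset (LowerSet X) := {I ∈ 𝓘 | ((I : Set X) ∩ A).Infinite}
  refine ⟨⋃ I ∈ J, (I : Set X),
    Finset.mem_image.2 ⟨J, Finset.mem_powerset.2 (Finset.filter_subset _ _), rfl⟩, ?_⟩
  have h₁ : (⋃ I ∈ J, (I : Set X) \ A).Finite :=
    J.finite_toSet.biUnion fun I hI =>
      hdich I (Finset.mem_filter.1 hI).1 (Finset.mem_filter.1 hI).2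
  have h₂ : (⋃ I ∈ 𝓘 \ J, (I : Set X) ∩ A).Finite :=
    (𝓘 \ J).finite_toSet.biUnion fun I hI => by
      by_contra h
      obtain ⟨hI, hIJ⟩ := Finset.mem_sdiff.1 hI
      exact hIJ (Finset.mem_filter.2 ⟨hI, h⟩)
  refine (h₂.union h₁).subset ?_
  rintro x (⟨hxA, hx⟩ | ⟨hx, hxA⟩)
  · obtain ⟨I, hI, hxI⟩ := hcover x
    refine Or.inl (mem_biUnion (Finset.mem_sdiff.2 ⟨hI, fun hIJ => hx ?_⟩) ⟨hxI, hxA⟩)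
    exact mem_biUnion hIJ hxI
  · obtain ⟨I, hI, hxI⟩ := mem_iUnion₂.1 hx
    exact Or.inr (mem_biUnion hI ⟨hxI, hxA⟩)

end Level

/-! ### Balls for a family of maps -/

/-- Points reached from `F` by applying at most `n` letters of `L`. -/
def wordBall {ι : Type*} (f : ι → X → X) (L : Set ι) (F : Set X) : ℕ → Set X
  | 0 => F
  | n + 1 => wordBall f L F n ∪ ⋃ l ∈ L, f l '' wordBall f L F n

theorem wordBall_finite {ι : Type*} (f : ι → X → X) {L : Set ι} (hL : L.Finite)
    {F : Set X} (hF : F.Finite) (n : ℕ) : (wordBall f L F n).Finite := by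
  induction n with
  | zero => exact hF
  | succ n ih => exact ih.union (hL.biUnion fun l _ => ih.image _)

/-! ### Letters in a virtually abelian group -/

theorem exists_finite_letters {G : Type w} [Group G] {H : Subgroup G} [H.FiniteIndex] [H.Normal]
    (hH : ∀ a ∈ H, ∀ b ∈ H, a * b = b * a) {S : Set G} (hS : S.Finite) :
    ∃ E L : Set G, L.Finite ∧ E ⊆ L ∧ S ⊆ L ∧ (∀ a ∈ E, ∀ b ∈ E, a * b = b * a) ∧
      ∀ a ∈ L, ∀ b ∈ L, ∃ e ∈ E, ∃ c ∈ L, a * b = e * c := by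
  let R : Set G := range (Quotient.out : G ⧸ H → G)
  have : Finite (G ⧸ H) := Subgroup.finite_quotient_of_finiteIndex
  have hR : R.Finite := finite_range (Quotient.out : G ⧸ H → G)
  have hRH : ∀ g : G, ∃ r ∈ R, r⁻¹ * g ∈ H := fun g =>
    ⟨_, mem_range_self (g : G ⧸ H), QuotientGroup.eq.1 (Quotient.out_eq _)⟩
  let T : Set G := R ∪ S
  have hT : T.Finite := hR.union hS
  let C : Set G := {c | c ∈ H ∧ c ∈ image2 (fun p r => p * r⁻¹) (image2 (· * ·) T T) R}
  have hC : C.Finite := ((hT.image2 _ hT).image2 _ hR).subset fun c hc => hc.2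
  let E : Set G := {e | ∃ g, ∃ c ∈ C, e = g * c * g⁻¹}
  have hEH : E ⊆ H := by
    rintro _ ⟨g, c, hc, rfl⟩
    exact Subgroup.Normal.conj_mem inferInstance c hc.1 g
  have hE : E.Finite := by
    refine (hR.image2 (fun r c => r * c * r⁻¹) hC).subset ?_
    rintro _ ⟨g, c, hc, rfl⟩
    obtain ⟨r, hr, hrg⟩ := hRH g
    refine ⟨r, hr, c, hc, ?_⟩
    have h := hH _ hrg c hc.1
    calc r * c * r⁻¹ = r * (c * (r⁻¹ * g)) * g⁻¹ := by group
      _ = r * (r⁻¹ * g * c) * g⁻¹ := by rw [h]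
      _ = g * c * g⁻¹ := by group
  refine ⟨E, E ∪ T, hE.union hT, subset_union_left,
    subset_union_right.trans subset_union_right,
    fun a ha b hb => hH a (hEH ha) b (hEH hb), ?_⟩
  rintro a (ha | ha) b hb
  · exact ⟨a, ha, b, hb, rfl⟩
  rcases hb with ⟨g, c, hc, rfl⟩ | hb
  · exact ⟨a * (g * c * g⁻¹) * a⁻¹, ⟨a * g, c, hc, by group⟩, a, Or.inr ha, by group⟩
  · obtain ⟨r, hr, hrab⟩ := hRH (a * b)
    refine ⟨a * b * r⁻¹, ⟨1, a * b * r⁻¹, ⟨?_, ?_⟩, by group⟩, r, Or.inr (Or.inl hr), by group⟩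
    · have h := Subgroup.Normal.conj_mem inferInstance _ hrab r
      have heq : r * (r⁻¹ * (a * b)) * r⁻¹ = a * b * r⁻¹ := by group
      rwa [heq] at h
    · exact mem_image2_of_mem (mem_image2_of_mem ha hb) hr

/-! ### Representatives of a near action -/

section Representatives

variable {G : Type w} [Group G] {α : G →* NearPerm X} {ρ : G → PartialEquiv X X}
  {hρ : ∀ g, IsCofinBij (ρ g)}

theorem exists_representatives (α : G →* NearPerm X) :
    ∃ (ρ : G → PartialEquiv X X) (hρ : ∀ g, IsCofinBij (ρ g)),
      ∀ g, NearPerm.mk (ρ g) (hρ g) = α g := by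
  have h : ∀ g, ∃ e : { e : PartialEquiv X X // IsCofinBij e }, NearPerm.mk e.1 e.2 = α g :=
    fun g => Quotient.exists_rep (α g)
  choose e he using h
  exact ⟨fun g => (e g).1, fun g => (e g).2, he⟩

theorem finite_ne_of_mk_eq {e e' : PartialEquiv X X} {he : IsCofinBij e} {he' : IsCofinBij e'}
    (h : NearPerm.mk e he = NearPerm.mk e' he') : {x | e x ≠ e' x}.Finite := by
  have hnear : NearEqv e e' := Quotient.exact h
  exact hnear.subset fun x hx hxe => hx hxe.2.2

theorem finite_representative_mul_ne (hα : ∀ g, NearPerm.mk (ρ g) (hρ g) = α g) (g h : G) :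
    {x | ρ g (ρ h x) ≠ ρ (g * h) x}.Finite := by
  refine finite_ne_of_mk_eq (e := (ρ h).trans (ρ g)) (he := (hρ h).trans (hρ g))
    (he' := hρ (g * h)) ?_
  rw [hα, map_mul, ← hα g, ← hα h]
  rfl

theorem finite_representative_one_ne (hα : ∀ g, NearPerm.mk (ρ g) (hρ g) = α g) :
    {x | ρ 1 x ≠ x}.Finite := by
  refine finite_ne_of_mk_eq (e' := PartialEquiv.refl X) (he := hρ 1) (he' := isCofinBij_refl) ?_
  rw [hα, map_one]
  rfl

theorem Commensurated.finite_not_mem_iff {A : Set X} (hA : Commensurated α A)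
    (hα : ∀ g, NearPerm.mk (ρ g) (hρ g) = α g) (g : G) :
    {x | ¬ (ρ g x ∈ A ↔ x ∈ A)}.Finite := by
  have hsymm := hA g (ρ g) (hρ g) (hα g)
  have hpre : ((ρ g).source ∩ ρ g ⁻¹' symmDiff (ρ g '' (A ∩ (ρ g).source)) A).Finite := by
    refine Set.Finite.of_finite_image (hsymm.subset ?_) ((ρ g).injOn.mono inter_subset_left)
    rintro _ ⟨x, ⟨_, hx⟩, rfl⟩
    exact hx
  refine ((hρ g).1.union hpre).subset fun x hx => ?_
  by_cases hxs : x ∈ (ρ g).source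
  · refine Or.inr ⟨hxs, ?_⟩
    by_cases hxA : x ∈ A
    · exact Or.inl ⟨⟨x, ⟨hxA, hxs⟩, rfl⟩, fun h => hx (iff_of_true h hxA)⟩
    · refine Or.inr ⟨?_, ?_⟩
      · by_contra h
        exact hx (iff_of_false h hxA)
      · rintro ⟨y, ⟨hyA, hys⟩, hyx⟩
        exact hxA ((ρ g).injOn hys hxs hyx ▸ hyA)
  · exact Or.inl hxs

theorem exists_finite_wordBall_cover (hα : ∀ g, NearPerm.mk (ρ g) (hρ g) = α g)
    {S : Finset G} {σ : G → PartialEquiv X X} {hσ : ∀ s ∈ S, IsCofinBij (σ s)}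
    (hσα : ∀ s (hs : s ∈ S), NearPerm.mk (σ s) (hσ s hs) = α s)
    (hcomp : Finite (Quotient (graphSetoid (S : Set G) σ)))
    {L : Set G} (hSL : ∀ s ∈ S, s ∈ L ∧ s⁻¹ ∈ L) :
    ∃ F : Set X, F.Finite ∧ ∀ x, ∃ n, x ∈ wordBall (fun g => ρ g) L F n := by
  let B : Set X := ⋃ s ∈ S, {x | σ s x ≠ ρ s x} ∪ {x | ρ s⁻¹ (ρ s x) ≠ x}
  have hB : B.Finite := by
    refine S.finite_toSet.biUnion fun s hs => ?_
    refine (finite_ne_of_mk_eq ((hσα s hs).trans (hα s).symm)).union ?_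
    refine ((finite_representative_mul_ne hα s⁻¹ s).union
      (finite_representative_one_ne hα)).subset fun x hx => ?_
    by_contra h
    rw [mem_union, not_or] at h
    refine hx ((not_not.1 h.1).trans ?_)
    rw [inv_mul_cancel]
    exact not_not.1 h.2
  let Q : Set X := range (Quotient.out : Quotient (graphSetoid (S : Set G) σ) → X)
  let F : Set X := Q ∪ (B ∪ ⋃ s ∈ S, σ s '' B)
  have hF : F.Finite := (finite_range _).union
    (hB.union (S.finite_toSet.biUnion fun s _ => hB.image _))
  refine ⟨F, hF, ?_⟩
  let P : X → Prop := fun x => ∃ n, x ∈ wordBall (fun g => ρ g) L F n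
  have hPF : ∀ x ∈ F, P x := fun x hx => ⟨0, hx⟩
  have hPL : ∀ l ∈ L, ∀ x, P x → P (ρ l x) := fun l hl x ⟨n, hn⟩ =>
    ⟨n + 1, Or.inr (mem_biUnion hl ⟨x, hn, rfl⟩)⟩
  have hPσ : ∀ s ∈ S, ∀ x, P x ↔ P (σ s x) := by
    intro s hs x
    by_cases hxB : x ∈ B
    · exact iff_of_true (hPF _ (Or.inr (Or.inl hxB)))
        (hPF _ (Or.inr (Or.inr (mem_biUnion (Finset.mem_coe.2 hs) ⟨x, hxB, rfl⟩))))
    · have hx : σ s x = ρ s x ∧ ρ s⁻¹ (ρ s x) = x := by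
        constructor <;> by_contra h
        · exact hxB (mem_biUnion (Finset.mem_coe.2 hs) (Or.inl h))
        · exact hxB (mem_biUnion (Finset.mem_coe.2 hs) (Or.inr h))
      rw [hx.1]
      refine ⟨hPL s (hSL s hs).1 x, fun h => ?_⟩
      have := hPL s⁻¹ (hSL s hs).2 _ h
      rwa [hx.2] at this
  have hstep : ∀ x y, Relation.EqvGen (graphStep (S : Set G) σ) x y → (P x ↔ P y) := by
    intro x y h
    induction h with
    | rel x y h =>
      obtain ⟨s, hs, ⟨_, rfl⟩ | ⟨_, rfl⟩⟩ := h
      · exact hPσ s hs x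
      · exact (hPσ s hs y).symm
    | refl x => rfl
    | symm _ _ _ ih => exact ih.symm
    | trans _ _ _ _ _ ih₁ ih₂ => exact ih₁.trans ih₂
  intro x
  have hrel : Relation.EqvGen (graphStep (S : Set G) σ)
      (Quotient.out (Quotient.mk (graphSetoid (S : Set G) σ) x)) x :=
    @Quotient.mk_out X (graphSetoid (S : Set G) σ) x
  exact (hstep _ _ hrel).1 (hPF _ (Or.inl (mem_range_self _)))

end Representatives

/-- Every near action of finite type of a finitely generated virtually abelian group is
finitely-ended: there are only finitely many commensurated subsets modulo finite
symmetric difference. -/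
theorem virtually_abelian_finite_type_near_action_finitely_ended
    {G : Type w} [Group G] [Group.FG G]
    (hVA : ∃ H : Subgroup G, H.FiniteIndex ∧ ∀ a b : H, a * b = b * a)
    {X : Type u} (α : G →* NearPerm X) (hFT : FiniteType α) :
    ∃ 𝒜 : Finset (Set X), ∀ A : Set X, Commensurated α A →
      ∃ B ∈ 𝒜, (symmDiff A B).Finite := by
  classical
  obtain ⟨H₀, hfin, hcomm⟩ := hVA
  have hH : ∀ a ∈ H₀.normalCore, ∀ b ∈ H₀.normalCore, a * b = b * a := fun a ha b hb =>
    congrArg Subtype.val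
      (hcomm ⟨a, H₀.normalCore_le ha⟩ ⟨b, H₀.normalCore_le hb⟩)
  obtain ⟨S, σ, hσ, -, hσα, hcomp⟩ := hFT
  obtain ⟨E, L, hL, hEL, hSL, hE, hEL_mul⟩ :=
    exists_finite_letters hH (S.finite_toSet.union S.finite_toSet.inv)
  obtain ⟨ρ, hρ, hα⟩ := exists_representatives α
  obtain ⟨F, hF, hcover⟩ := exists_finite_wordBall_cover hα hσα hcomp
    (L := L) fun s hs => ⟨hSL (Or.inl hs), hSL (Or.inr (by simpa using hs))⟩
  let lev : X → ℕ := fun x => Nat.find (hcover x)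
  have hlev : ∀ x n, x ∈ wordBall (fun g => ρ g) L F n → lev x ≤ n := fun x n hn =>
    Nat.find_min' (hcover x) hn
  have hmem : ∀ x, x ∈ wordBall (fun g => ρ g) L F (lev x) := fun x => Nat.find_spec (hcover x)
  have hmono : Monotone (wordBall (fun g => ρ g) L F) :=
    monotone_nat_of_le_succ fun n => subset_union_left
  have hlevfin : ∀ n, {x | lev x ≤ n}.Finite := fun n =>
    (wordBall_finite _ hL hF n).subset fun x hx => hmono hx (hmem x)
  have hlip : ∀ l ∈ L, ∀ x, lev (ρ l x) ≤ lev x + 1 := fun l hl x =>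
    hlev _ _ (Or.inr (mem_biUnion hl ⟨x, hmem x, rfl⟩))
  have hpredL : ∀ x, 0 < lev x → ∃ l ∈ L, ∃ y, lev y + 1 = lev x ∧ ρ l y = x := by
    intro x hx
    obtain ⟨n, hn⟩ := Nat.exists_eq_succ_of_ne_zero hx.ne'
    have h := hmem x
    rw [hn] at h
    rcases h with h | h
    · have := hlev x n h
      omega
    · obtain ⟨l, hl, y, hy, hyx⟩ := mem_iUnion₂.1 h
      have h₁ := hlev y n hy
      have h₂ := hlip l hl y
      rw [show ρ l y = x from hyx] at h₂
      exact ⟨l, hl, y, by omega, hyx⟩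
  have hbad : (⋃ a ∈ L, ⋃ b ∈ L, {x | ρ a (ρ b x) ≠ ρ (a * b) x}).Finite :=
    hL.biUnion fun a _ => hL.biUnion fun b _ => finite_representative_mul_ne hα a b
  obtain ⟨N, hN⟩ := exists_level_bound lev hbad
  have hmul : ∀ x, N ≤ lev x → ∀ a ∈ L, ∀ b ∈ L, ρ a (ρ b x) = ρ (a * b) x := by
    intro x hx a ha b hb
    by_contra h
    exact hN x hx (mem_biUnion ha (mem_biUnion hb h))
  have : Finite E := hL.subset hEL
  obtain ⟨𝒜, h𝒜⟩ := exists_finset_of_almost_invariant (f := fun (e : E) x => ρ e x) (lev := lev)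
    (N := N + 1) hlevfin (fun e => hlip e (hEL e.2))
    (fun x hx a b => by
      rw [hmul x (by omega) a (hEL a.2) b (hEL b.2), hmul x (by omega) b (hEL b.2) a (hEL a.2),
        hE a a.2 b b.2])
    (fun x hx => by
      obtain ⟨a, ha, y, hy, rfl⟩ := hpredL x (by omega)
      obtain ⟨b, hb, z, hz, rfl⟩ := hpredL y (by omega)
      obtain ⟨e, he, c, hc, habec⟩ := hEL_mul a ha b hb
      have hrw : ρ a (ρ b z) = ρ e (ρ c z) := by
        rw [hmul z (by omega) a ha b hb, habec, hmul z (by omega) e (hEL he) c hc]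
      refine ⟨⟨e, he⟩, ρ c z, ?_, hrw.symm⟩
      have h₁ := hlip c hc z
      have h₂ := hlip e (hEL he) (ρ c z)
      rw [← hrw] at h₂
      omega)
  exact ⟨𝒜, fun A hA => h𝒜 A fun e => hA.finite_not_mem_iff hα e⟩
end

section
/- Let G be a finitely generated abelian group of ℚ-rank at least 3 (i.e., G ≅ ℤ^d × F with d ≥ 3 and F finite abelian). Let α : G → S⋆(X) be a near action on a set X that is near free (for every g ≠ 1 and every representative σ of α(g), the set {x ∈ dom(σ) : σ(x) = x} is finite) and 1-ended (X is infinite and every α-commensurated subset of X is finite or has finite complement). Then X is near isomorphic to the simply transitive action of G on itself: there exist cofinite subsets X' ⊆ X and G' ⊆ G and a bijection f : X' → G' such that for every g ∈ G and every representative σ of α(g), f(σ(x)) = g·f(x) for all but finitely many x ∈ X'. -/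
open Set

universe u v w

variable {X : Type u}

open Filter

/-- If a function on an abelian group containing two independent elements of infinite order is
near invariant under translations, then it is constant on a cofinite set. -/
theorem eventually_eq_of_near_invariant {Q : Type*} [CommGroup Q] {C : Type*} {b c : Q}
    (hbc : ∀ i j : ℤ, b ^ i * c ^ j = 1 → i = 0 ∧ j = 0) (φ : Q → C)
    (hφ : ∀ s, ∀ᶠ q in cofinite, φ (s * q) = φ q) :
    ∃ q₁, ∀ᶠ q in cofinite, φ q = φ q₁ := by
  have hinj : ∀ q, Function.Injective fun z : ℕ × ℕ => c ^ z.2 * (b ^ z.1 * q) := by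
    rintro q ⟨m, n⟩ ⟨m', n'⟩ h
    have h' : b ^ ((m : ℤ) - m') * c ^ ((n : ℤ) - n') = 1 := by
      simp only [← mul_assoc] at h
      have h2 := mul_right_cancel h
      rw [zpow_sub, zpow_sub]
      simp only [zpow_natCast]
      rw [mul_mul_mul_comm, mul_comm (b ^ m), h2, ← mul_inv, mul_comm (b ^ m')]
      exact mul_inv_cancel _
    have := hbc _ _ h'
    ext <;> simp <;> omega
  have hcinj : ∀ q, Function.Injective fun n : ℕ => c ^ n * q := fun q n n' h => by
    have := @hinj q (0, n) (0, n') (by simpa using h)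
    simpa using this
  have hbad : ∀ (d q : Q), (¬ ∀ n : ℕ, φ (d ^ n * q) = φ q) →
      ∃ n : ℕ, d ^ n * q ∈ {q | φ (d * q) ≠ φ q} := by
    intro d q h
    by_contra! hc
    refine h fun n => ?_
    induction n with
    | zero => simp
    | succ n ih =>
      have := hc n
      simp only [Set.mem_ofPred_eq, not_not] at this
      rw [pow_succ', mul_assoc, this, ih]
  have hfin : ∀ d, {q | φ (d * q) ≠ φ q}.Finite := hφ
  have hmove : ∀ q, ∃ m : ℕ, ∀ n : ℕ, φ (c ^ n * (b ^ m * q)) = φ (b ^ m * q) := by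
    intro q
    by_contra! hc
    have hc' : ∀ m : ℕ, ∃ n : ℕ, c ^ n * (b ^ m * q) ∈ {q | φ (c * q) ≠ φ q} := fun m =>
      hbad c _ (by push Not; exact hc m)
    choose n hn using hc'
    have hi : Function.Injective fun m : ℕ => c ^ n m * (b ^ m * q) := fun m m' h => by
      have := @hinj q (m, n m) (m', n m') h
      exact (Prod.ext_iff.1 this).1
    exact Set.infinite_of_injective_forall_mem hi hn (hfin c)
  have hconst : ∀ q q', (∀ n : ℕ, φ (c ^ n * q) = φ q) → (∀ n : ℕ, φ (c ^ n * q') = φ q') →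
      φ q = φ q' := by
    intro q q' h h'
    have ht : Tendsto (fun n : ℕ => c ^ n * q) atTop cofinite := by
      rw [← Nat.cofinite_eq_atTop]; exact (hcinj q).tendsto_cofinite
    obtain ⟨n, hn⟩ := (ht.eventually (hφ (q' * q⁻¹))).exists
    rw [h, ← h' n] at *
    rw [← hn]
    congr 1
    rw [mul_comm q', mul_assoc, mul_left_comm q', mul_comm q', mul_left_comm, inv_mul_cancel_left]
  obtain ⟨m₁, h₁⟩ := hmove 1
  refine ⟨b ^ m₁ * 1, ?_⟩
  have key : {q | φ q ≠ φ (b ^ m₁ * 1)} ⊆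
      ⋃ u ∈ {q | φ (c * q) ≠ φ q}, ⋃ v ∈ {q | φ (b * q) ≠ φ q},
        {q | ∃ n m : ℕ, c ^ n * q = u ∧ b ^ m * q = v} := by
    intro q hq
    by_cases hb : ∀ n : ℕ, φ (b ^ n * q) = φ q
    · obtain ⟨m, hm⟩ := hmove q
      exact absurd ((hb m).symm.trans (hconst _ _ hm h₁)) hq
    by_cases hc : ∀ n : ℕ, φ (c ^ n * q) = φ q
    · exact absurd (hconst _ _ hc h₁) hq
    obtain ⟨n, hn⟩ := hbad c q hc
    obtain ⟨m, hm⟩ := hbad b q hb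
    simp only [Set.mem_iUnion]
    exact ⟨_, hn, _, hm, n, m, rfl, rfl⟩
  refine Set.Finite.subset ((hfin c).biUnion fun u _ => (hfin b).biUnion fun v _ => ?_) key
  refine Set.Subsingleton.finite ?_
  rintro q ⟨n, m, h1, h2⟩ q' ⟨n', m', h1', h2'⟩
  have e1 : q = c ^ ((n' : ℤ) - n) * q' := by
    rw [sub_eq_neg_add, zpow_add, zpow_neg, zpow_natCast, zpow_natCast, mul_assoc, h1', ← h1,
      inv_mul_cancel_left]
  have e2 : q = b ^ ((m' : ℤ) - m) * q' := by
    rw [sub_eq_neg_add, zpow_add, zpow_neg, zpow_natCast, zpow_natCast, mul_assoc, h2', ← h2,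
      inv_mul_cancel_left]
  have e3 := mul_right_cancel (e1.symm.trans e2)
  have e4 := hbc (-((m' : ℤ) - m)) ((n' : ℤ) - n) (by rw [e3, ← zpow_add]; simp)
  rw [e1, e4.2, zpow_zero, one_mul]

/-- A property holds on a cofinite subset of `G` as soon as it holds on almost all cosets of an
infinite cyclic subgroup and, on each coset, at all points far enough in both directions. -/
theorem eventually_cofinite_of_zpowers {G : Type*} [CommGroup G] {a : G} {P : G → Prop}
    (hq : ∀ᶠ q : G ⧸ Subgroup.zpowers a in cofinite,
      ∀ g : G, (g : G ⧸ Subgroup.zpowers a) = q → P g)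
    (hpos : ∀ g, ∀ᶠ n : ℕ in atTop, P (a ^ n * g))
    (hneg : ∀ g, ∀ᶠ n : ℕ in atTop, P (a⁻¹ ^ n * g)) : ∀ᶠ g in cofinite, P g := by
  have hsub : {g | ¬ P g} ⊆
      ⋃ q ∈ {q : G ⧸ Subgroup.zpowers a | ¬ ∀ g : G, (g : G ⧸ Subgroup.zpowers a) = q → P g},
        (fun k : ℤ => a ^ k * q.out) '' {k : ℤ | ¬ P (a ^ k * q.out)} := by
    intro g hg
    have hout : ((g : G ⧸ Subgroup.zpowers a).out : G ⧸ Subgroup.zpowers a) = g :=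
      Quotient.out_eq _
    obtain ⟨k, hk⟩ := Subgroup.mem_zpowers_iff.1 (QuotientGroup.eq.1 hout)
    have hk' : a ^ k * (g : G ⧸ Subgroup.zpowers a).out = g := by
      rw [hk, mul_comm, mul_inv_cancel_left]
    simp only [Set.mem_iUnion]
    refine ⟨(g : G ⧸ Subgroup.zpowers a), fun h => hg (h g rfl), k, ?_, hk'⟩
    change ¬ P _
    rwa [hk']
  refine Set.Finite.subset (Set.Finite.biUnion hq fun q _ => Set.Finite.image _ ?_) hsub
  obtain ⟨N, hN⟩ := eventually_atTop.1 (hpos q.out)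
  obtain ⟨M, hM⟩ := eventually_atTop.1 (hneg q.out)
  refine (Set.finite_Icc (-(M : ℤ)) N).subset fun k hk => ?_
  by_contra hc
  rw [Set.mem_Icc, not_and_or] at hc
  refine hk ?_
  rcases hc with hc | hc
  · have := hM k.natAbs (by omega)
    rwa [← zpow_natCast, inv_zpow', show -(k.natAbs : ℤ) = k by omega] at this
  · have := hN k.natAbs (by omega)
    rwa [← zpow_natCast, show (k.natAbs : ℤ) = k by omega] at this

/-- A family of self-maps of `X`, indexed by a group, which is a near free near action up to
finite error. -/
structure IsNearFreeFamily {G : Type w} [Group G] (σ : G → X → X) : Prop where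
  one : ∀ᶠ x in cofinite, σ 1 x = x
  mul : ∀ g h, ∀ᶠ x in cofinite, σ (g * h) x = σ g (σ h x)
  tendsto : ∀ g, Tendsto (σ g) cofinite cofinite
  free : ∀ g, g ≠ 1 → ∀ᶠ x in cofinite, σ g x ≠ x

/-- The forward orbit of `x` under `p` is a ray. -/
def IsRay (p : Equiv.Perm X) (x : X) : Prop := Function.Injective fun n : ℕ => (p ^ n) x

/-- The map `σ g` sends the germ of the ray of `y` to the germ of the ray of `x`. -/
def RayRel {G : Type w} (σ : G → X → X) (p : Equiv.Perm X) (g : G) (y x : X) : Prop :=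
  ∀ᶠ n : ℕ in atTop, σ g ((p ^ n) y) = (p ^ n) x

section Ray

variable {p : Equiv.Perm X} {x y z : X}

theorem IsRay.tendsto (h : IsRay p x) : Tendsto (fun n : ℕ => (p ^ n) x) atTop cofinite := by
  rw [← Nat.cofinite_eq_atTop]; exact h.tendsto_cofinite

theorem isRay_iff : IsRay p x ↔ ∀ n : ℕ, n ≠ 0 → (p ^ n) x ≠ x := by
  constructor
  · intro h n hn h'
    exact hn (@h n 0 (by simpa using h'))
  · intro h n m hnm
    wlog hlt : n < m generalizing n m
    · rcases lt_trichotomy n m with h1 | h1 | h1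
      · exact this hnm h1
      · exact h1
      · exact (this hnm.symm h1).symm
    refine absurd ?_ (h (m - n) (by omega))
    refine (p ^ n).injective ?_
    rw [← Equiv.Perm.mul_apply, ← pow_add, Nat.add_sub_cancel' hlt.le]
    exact hnm.symm

theorem IsRay.inv (h : IsRay p x) : IsRay p⁻¹ x := by
  rw [isRay_iff] at h ⊢
  intro n hn h'
  rw [inv_pow, Equiv.Perm.inv_eq_iff_eq] at h'
  exact h n hn h'.symm

theorem IsRay.of_tendsto (h : Tendsto (fun n : ℕ => (p ^ n) x) atTop cofinite) : IsRay p x := by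
  rw [isRay_iff]
  intro n hn hx
  have h1 : ∀ᶠ m : ℕ in atTop, (p ^ m) x ≠ x :=
    h.eventually (Set.finite_singleton x).compl_mem_cofinite
  obtain ⟨N, hN⟩ := eventually_atTop.1 h1
  refine hN (n * N) (Nat.le_mul_of_pos_left N (Nat.pos_of_ne_zero hn)) ?_
  rw [pow_mul]
  exact Function.IsFixedPt.perm_pow hx N

variable {G : Type w} {σ : G → X → X} {g h : G}

theorem RayRel.unique (hg : RayRel σ p g y x) (hg' : RayRel σ p g y z) : x = z := by
  obtain ⟨n, h1, h2⟩ := (hg.and hg').exists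
  exact (p ^ n).injective (h1.symm.trans h2)

theorem rayRel_of_commute (h : ∀ n : ℕ, σ g (p ((p ^ n) x)) = p (σ g ((p ^ n) x))) :
    RayRel σ p g x (σ g x) := by
  refine Eventually.of_forall fun n => ?_
  induction n with
  | zero => simp
  | succ n ih => rw [pow_succ', Equiv.Perm.mul_apply, Equiv.Perm.mul_apply, h n, ih]

theorem exists_rayRel (hp : ∀ g, ∀ᶠ x in cofinite, σ g (p x) = p (σ g x)) (hy : IsRay p y)
    (g : G) : ∃ x, RayRel σ p g y x := by
  obtain ⟨N, hN⟩ := eventually_atTop.1 (hy.tendsto.eventually (hp g))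
  refine ⟨(p ^ N)⁻¹ (σ g ((p ^ N) y)), eventually_atTop.2 ⟨N, fun n hn => ?_⟩⟩
  induction n, hn using Nat.le_induction with
  | base => rw [Equiv.Perm.coe_inv, Equiv.apply_symm_apply]
  | succ n hn ih =>
    rw [pow_succ', Equiv.Perm.mul_apply, Equiv.Perm.mul_apply, hN n hn, ih]

variable [CommGroup G]

namespace IsNearFreeFamily

theorem rayRel_one (hσ : IsNearFreeFamily σ) (hx : IsRay p x) : RayRel σ p 1 x x :=
  hx.tendsto.eventually hσ.one

theorem rayRel_mul (hσ : IsNearFreeFamily σ) (hy : IsRay p y) (hg : RayRel σ p g y x)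
    (hh : RayRel σ p h x z) : RayRel σ p (h * g) y z := by
  filter_upwards [hg, hh, hy.tendsto.eventually (hσ.mul h g)] with n h1 h2 h3
  rw [h3, h1, h2]

theorem rayRel_inv (hσ : IsNearFreeFamily σ) (hy : IsRay p y) (hg : RayRel σ p g y x) :
    RayRel σ p g⁻¹ x y := by
  filter_upwards [hg, hy.tendsto.eventually (hσ.mul g⁻¹ g), hy.tendsto.eventually hσ.one]
    with n h1 h2 h3
  rw [← h1, ← h2, inv_mul_cancel, h3]

theorem isRay_of_rayRel (hσ : IsNearFreeFamily σ) (hy : IsRay p y) (hg : RayRel σ p g y x) :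
    IsRay p x :=
  IsRay.of_tendsto (((hσ.tendsto g).comp hy.tendsto).congr' hg)

theorem eq_of_rayRel (hσ : IsNearFreeFamily σ) (hy : IsRay p y) (hg : RayRel σ p g y x)
    (hh : RayRel σ p h y x) : g = h := by
  by_contra hne
  have h1 := hσ.rayRel_mul hy hg (hσ.rayRel_inv hy hh)
  obtain ⟨n, hn, hn'⟩ := (h1.and (hy.tendsto.eventually
    (hσ.free (h⁻¹ * g) fun e => hne (inv_mul_eq_one.1 e).symm))).exists
  exact hn' hn

end IsNearFreeFamily

end Ray

/-- For every `g`, the map `σ g` sends the germ of the ray of `y` to the germ of the ray of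
`F g`. -/
structure IsRayMap {G : Type w} [CommGroup G] (σ : G → X → X) (p : Equiv.Perm X) (y : X)
    (F : G → X) : Prop where
  near : IsNearFreeFamily σ
  ray : IsRay p y
  rel : ∀ g, RayRel σ p g y (F g)

namespace IsRayMap

variable {G : Type w} [CommGroup G] {σ : G → X → X} {p a : Equiv.Perm X} {a₀ : G} {y : X}
  {F : G → X}

theorem injective (hF : IsRayMap σ p y F) : Function.Injective F := fun g h e =>
  hF.near.eq_of_rayRel hF.ray (hF.rel g) (e ▸ hF.rel h)

theorem isRay (hF : IsRayMap σ p y F) (g : G) : IsRay p (F g) :=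
  hF.near.isRay_of_rayRel hF.ray (hF.rel g)

theorem rayRel (hF : IsRayMap σ p y F) (s g : G) : RayRel σ p s (F g) (F (s * g)) := by
  have h := hF.near.rayRel_mul (hF.isRay g) (hF.near.rayRel_inv hF.ray (hF.rel g)) (hF.rel (s * g))
  rwa [mul_inv_cancel_right] at h

theorem map_mul (hF : IsRayMap σ p y F) (hap : Commute a p)
    (ha : ∀ᶠ x in cofinite, σ a₀ x = a x) (g : G) : F (a₀ * g) = a (F g) := by
  refine (hF.rayRel a₀ g).unique ?_
  filter_upwards [(hF.isRay g).tendsto.eventually ha] with n hn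
  rw [hn, ← Equiv.Perm.mul_apply, ← Equiv.Perm.mul_apply, (hap.pow_right n).eq]

theorem map_pow_mul (hF : IsRayMap σ p y F) (hap : Commute a p)
    (ha : ∀ᶠ x in cofinite, σ a₀ x = a x) (g : G) (n : ℕ) :
    F (a₀ ^ n * g) = (a ^ n) (F g) := by
  induction n with
  | zero => simp
  | succ n ih =>
    rw [pow_succ', mul_assoc, hF.map_mul hap ha, ih, pow_succ', Equiv.Perm.mul_apply]

end IsRayMap

theorem IsNearFreeFamily.exists_isRayMap {G : Type w} [CommGroup G] {σ : G → X → X}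
    (hσ : IsNearFreeFamily σ) {p : Equiv.Perm X}
    (hp : ∀ g, ∀ᶠ x in cofinite, σ g (p x) = p (σ g x)) {y : X} (hy : IsRay p y) :
    ∃ F, IsRayMap σ p y F := by
  choose F hF using exists_rayRel hp hy
  exact ⟨F, hσ, hy, hF⟩

/-- If the permutation `a` near represents `a₀`, then `a⁻¹` near represents `a₀⁻¹`. -/
theorem IsNearFreeFamily.eventually_inv_eq {G : Type w} [CommGroup G] {σ : G → X → X}
    (hσ : IsNearFreeFamily σ) {a : Equiv.Perm X} {a₀ : G}
    (ha : ∀ᶠ x in cofinite, σ a₀ x = a x) : ∀ᶠ x in cofinite, σ a₀⁻¹ x = a⁻¹ x := by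
  have ht : Tendsto (⇑a⁻¹) cofinite cofinite := (a⁻¹).injective.tendsto_cofinite
  filter_upwards [ht.eventually ha, ht.eventually (hσ.mul a₀⁻¹ a₀), ht.eventually hσ.one]
    with x h1 h2 h3
  rw [inv_mul_cancel, h3, h1, Equiv.Perm.coe_inv, Equiv.apply_symm_apply] at h2
  exact h2.symm

theorem IsNearFreeFamily.eventually_commute {G : Type w} [CommGroup G] {σ : G → X → X}
    (hσ : IsNearFreeFamily σ) {a : Equiv.Perm X} {a₀ : G}
    (ha : ∀ᶠ x in cofinite, σ a₀ x = a x) (g : G) :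
    ∀ᶠ x in cofinite, σ g (a x) = a (σ g x) := by
  filter_upwards [ha, (hσ.tendsto g).eventually ha, hσ.mul g a₀, hσ.mul a₀ g] with x h1 h2 h3 h4
  rw [← h1, ← h2, ← h3, ← h4, mul_comm]

theorem IsNearFreeFamily.eventually_pow_eq {G : Type w} [CommGroup G] {σ : G → X → X}
    (hσ : IsNearFreeFamily σ) {a : Equiv.Perm X} {a₀ : G}
    (ha : ∀ᶠ x in cofinite, σ a₀ x = a x) (n : ℕ) :
    ∀ᶠ x in cofinite, σ (a₀ ^ n) x = (a ^ n) x := by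
  induction n with
  | zero => simpa using hσ.one
  | succ n ih =>
    filter_upwards [ha, a.injective.tendsto_cofinite.eventually ih, hσ.mul (a₀ ^ n) a₀]
      with x h1 h2 h3
    rw [pow_succ, h3, h1, h2, pow_succ, Equiv.Perm.mul_apply]

theorem exists_split_preimage {X : Type*} [Infinite X] (π : X → ℕ)
    (hπ : ∀ n, {x | π x = n}.Finite) :
    ∃ M : Set ℕ, (π ⁻¹' M).Infinite ∧ (π ⁻¹' M)ᶜ.Infinite := by
  have hr : (Set.range π).Infinite := by
    intro hfin
    refine Set.infinite_univ (α := X) ((hfin.biUnion fun n _ => hπ n).subset fun x _ => ?_)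
    simp only [Set.mem_iUnion]
    exact ⟨π x, ⟨x, rfl⟩, rfl⟩
  let f := hr.natEmbedding
  have hf : ∀ n, ∃ x, π x = f n := fun n => (f n).2
  choose u hu using hf
  have hui : Function.Injective u := fun n m h => f.injective (Subtype.ext (by rw [← hu, ← hu, h]))
  refine ⟨Set.range fun n => (f (2 * n) : ℕ), ?_, ?_⟩
  · refine Set.infinite_of_injective_forall_mem (f := fun n => u (2 * n)) (fun n m h => ?_) ?_
    · have := hui h; omega
    · exact fun n => ⟨n, (hu _).symm⟩
  · refine Set.infinite_of_injective_forall_mem (f := fun n => u (2 * n + 1)) (fun n m h => ?_) ?_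
    · have := hui h; omega
    · rintro n ⟨m, hm⟩
      have := f.injective (Subtype.ext (hm.trans (hu _)))
      omega

theorem IsNearFreeFamily.exists_isRay {G : Type w} [CommGroup G] [Infinite X] {σ : G → X → X}
    (hσ : IsNearFreeFamily σ)
    (h1 : ∀ A : Set X, (∀ g, ∀ᶠ x in cofinite, x ∈ A → σ g x ∈ A) → A.Finite ∨ Aᶜ.Finite)
    {a : Equiv.Perm X} {a₀ : G} (ha : ∀ᶠ x in cofinite, σ a₀ x = a x)
    (ha₀ : ∀ n : ℕ, n ≠ 0 → a₀ ^ n ≠ 1) : ∃ x, IsRay a x := by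
  by_contra! hno
  set π : X → ℕ := fun x => Function.minimalPeriod a x with hπ
  have hper : ∀ x, (a ^ π x) x = x := fun x => by
    rw [← Equiv.Perm.iterate_eq_pow]
    exact Function.isPeriodicPt_minimalPeriod a x
  have hpos : ∀ x, π x ≠ 0 := by
    intro x h0
    have := hno x
    rw [isRay_iff] at this
    push Not at this
    obtain ⟨n, hn, hx⟩ := this
    rw [← Equiv.Perm.iterate_eq_pow] at hx
    exact (Function.IsPeriodicPt.minimalPeriod_pos (Nat.pos_of_ne_zero hn) hx).ne' h0
  have hfib : ∀ n, {x | π x = n}.Finite := by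
    intro n
    rcases eq_or_ne n 0 with rfl | hn
    · exact Set.finite_empty.subset fun x hx => (hpos x hx).elim
    have : ∀ᶠ x in cofinite, (a ^ n) x ≠ x := by
      filter_upwards [hσ.eventually_pow_eq ha n, hσ.free _ (ha₀ n hn)] with x e1 e2
      rwa [← e1]
    refine Set.Finite.subset this ?_
    rintro x rfl
    exact fun h => h (hper x)
  have hπa : ∀ n : ℕ, ∀ x, π ((a ^ n) x) = π x := by
    intro n x
    refine Function.minimalPeriod_eq_minimalPeriod_iff.2 fun m => ?_
    simp only [Function.IsPeriodicPt, Function.IsFixedPt, Equiv.Perm.iterate_eq_pow]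
    rw [← Equiv.Perm.mul_apply, ← pow_add, add_comm, pow_add, Equiv.Perm.mul_apply]
    exact (a ^ n).injective.eq_iff
  have hinv : ∀ g, ∀ᶠ x in cofinite, π (σ g x) = π x := by
    intro g
    have hU : ∀ᶠ x in cofinite, σ g (a x) = a (σ g x) ∧ σ g⁻¹ (σ g x) = x := by
      filter_upwards [hσ.eventually_commute ha g, hσ.mul g⁻¹ g, hσ.one] with x e1 e2 e3
      exact ⟨e1, by rw [← e2, inv_mul_cancel, e3]⟩
    have hU' : ∀ᶠ x in cofinite, ∀ n : ℕ, σ g (a ((a ^ n) x)) = a (σ g ((a ^ n) x)) ∧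
        σ g⁻¹ (σ g ((a ^ n) x)) = (a ^ n) x := by
      refine Set.Finite.subset (Set.Finite.biUnion hU fun u _ => hfib (π u)) fun x hx => ?_
      simp only [Set.mem_compl_iff, Set.mem_ofPred_eq, not_forall] at hx
      obtain ⟨n, hn⟩ := hx
      simp only [Set.mem_iUnion]
      exact ⟨_, hn, (hπa n x).symm⟩
    filter_upwards [hU'] with x hx
    have hc : ∀ n : ℕ, σ g ((a ^ n) x) = (a ^ n) (σ g x) := by
      intro n
      induction n with
      | zero => simp
      | succ n ih => rw [pow_succ', Equiv.Perm.mul_apply, Equiv.Perm.mul_apply, (hx n).1, ih]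
    refine Function.minimalPeriod_eq_minimalPeriod_iff.2 fun m => ?_
    simp only [Function.IsPeriodicPt, Function.IsFixedPt, Equiv.Perm.iterate_eq_pow]
    rw [← hc m]
    constructor
    · intro h
      rw [← (hx m).2, h]
      simpa using (hx 0).2
    · intro h
      rw [h]
  obtain ⟨M, hM, hM'⟩ := exists_split_preimage π hfib
  refine (h1 (π ⁻¹' M) fun g => ?_).elim hM hM'
  filter_upwards [hinv g] with x hx hxM
  rwa [Set.mem_preimage, hx]

section Comparison

variable {G : Type w} [CommGroup G] {σ : G → X → X} {a : Equiv.Perm X} {a₀ : G}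

namespace IsRayMap

variable {y : X} {F F' : G → X}

theorem map_zpow_mul (hF : IsRayMap σ a y F) (ha : ∀ᶠ x in cofinite, σ a₀ x = a x) (g : G)
    (k : ℤ) : F (a₀ ^ k * g) = (a ^ k) (F g) := by
  obtain ⟨n, rfl | rfl⟩ := k.eq_nat_or_neg
  · simpa using hF.map_pow_mul (Commute.refl a) ha g n
  · simpa using hF.map_pow_mul (Commute.refl a).inv_left (hF.near.eventually_inv_eq ha) g n

/-- Outside finitely many cosets of `a₀`, a ray map for `a` is equivariant for `s`, in both
directions along `a`. -/
theorem eventually_rayRel (hF : IsRayMap σ a y F) (ha : ∀ᶠ x in cofinite, σ a₀ x = a x) (s : G) :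
    ∀ᶠ q : G ⧸ Subgroup.zpowers a₀ in cofinite, ∀ g : G, (g : G ⧸ Subgroup.zpowers a₀) = q →
      F (s * g) = σ s (F g) ∧ RayRel σ a s (F g) (F (s * g)) ∧
        RayRel σ a⁻¹ s (F g) (F (s * g)) := by
  have hT : ∀ᶠ x in cofinite, σ s (a x) = a (σ s x) ∧ σ s (a⁻¹ x) = a⁻¹ (σ s x) :=
    (hF.near.eventually_commute ha s).and
      (hF.near.eventually_commute (hF.near.eventually_inv_eq ha) s)
  have hT' := hF.injective.tendsto_cofinite.eventually hT
  refine Set.Finite.subset (Set.Finite.image (QuotientGroup.mk : G → G ⧸ Subgroup.zpowers a₀) hT')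
    fun q hq => ?_
  by_contra hc
  refine hq ?_
  rintro g rfl
  have hg : ∀ k : ℤ, σ s (a ((a ^ k) (F g))) = a (σ s ((a ^ k) (F g))) ∧
      σ s (a⁻¹ ((a ^ k) (F g))) = a⁻¹ (σ s ((a ^ k) (F g))) := by
    intro k
    by_contra hk
    refine hc ⟨a₀ ^ k * g, ?_, ?_⟩
    · rw [← hF.map_zpow_mul ha] at hk
      exact hk
    · refine QuotientGroup.eq.2 (Subgroup.mem_zpowers_iff.2 ⟨-k, ?_⟩)
      rw [mul_inv_rev, mul_comm, ← mul_assoc, mul_inv_cancel, one_mul, zpow_neg]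
  have h1 : RayRel σ a s (F g) (σ s (F g)) := rayRel_of_commute fun n => by
    simpa using (hg n).1
  have h2 : RayRel σ a⁻¹ s (F g) (σ s (F g)) := rayRel_of_commute fun n => by
    simpa using (hg (-n)).2
  have h3 := (hF.rayRel s g).unique h1
  rw [h3]
  exact ⟨rfl, h1, h2⟩

end IsRayMap

/-- The points of `X` obtained from `x` by the same group element along the forward and the
backward rays. -/
def twoSidedClass (σ : G → X → X) (a : Equiv.Perm X) (x : X) : Set X :=
  {z | ∃ h, RayRel σ a h x z ∧ RayRel σ a⁻¹ h x z}

theorem IsNearFreeFamily.twoSidedClass_subset (hσ : IsNearFreeFamily σ) {x z : X} {s : G}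
    (hx : IsRay a x) (h1 : RayRel σ a s x z) (h2 : RayRel σ a⁻¹ s x z) :
    twoSidedClass σ a z ⊆ twoSidedClass σ a x := fun _ ⟨h, e1, e2⟩ =>
  ⟨h * s, hσ.rayRel_mul hx h1 e1, hσ.rayRel_mul hx.inv h2 e2⟩

theorem IsNearFreeFamily.twoSidedClass_eq (hσ : IsNearFreeFamily σ) {x z : X} {s : G}
    (hx : IsRay a x) (h1 : RayRel σ a s x z) (h2 : RayRel σ a⁻¹ s x z) :
    twoSidedClass σ a z = twoSidedClass σ a x :=
  (hσ.twoSidedClass_subset hx h1 h2).antisymm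
    (hσ.twoSidedClass_subset (hσ.isRay_of_rayRel hx h1) (hσ.rayRel_inv hx h1)
      (hσ.rayRel_inv hx.inv h2))

/-- There are a forward and a backward ray map which agree outside finitely many cosets. -/
theorem IsNearFreeFamily.exists_isRayMap_pair (hσ : IsNearFreeFamily σ)
    (ha : ∀ᶠ x in cofinite, σ a₀ x = a x) {b c : G}
    (hind : ∀ i j k : ℤ, a₀ ^ i * b ^ j * c ^ k = 1 → i = 0 ∧ j = 0 ∧ k = 0)
    {x₀ : X} (hx₀ : IsRay a x₀) :
    ∃ (y : X) (F F' : G → X), IsRayMap σ a y F ∧ IsRayMap σ a⁻¹ y F' ∧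
      ∀ᶠ q : G ⧸ Subgroup.zpowers a₀ in cofinite, ∀ g : G, (g : G ⧸ Subgroup.zpowers a₀) = q →
        F g = F' g := by
  obtain ⟨F₀, hF₀⟩ := hσ.exists_isRayMap (hσ.eventually_commute ha) hx₀
  let φ : G ⧸ Subgroup.zpowers a₀ → Set X := fun q => q.liftOn
    (fun g => twoSidedClass σ a (F₀ g)) (by
      intro g h hgh
      obtain ⟨k, hk⟩ := Subgroup.mem_zpowers_iff.1 (QuotientGroup.leftRel_apply.1 hgh)
      have hh : h = a₀ ^ k * g := by rw [hk, mul_comm, mul_inv_cancel_left]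
      refine (hσ.twoSidedClass_eq (s := a₀ ^ k) (hF₀.isRay g) ?_ ?_).symm
      · rw [hh]; exact hF₀.rayRel _ _
      · rw [hh, hF₀.map_zpow_mul ha]
        have hz : ∀ᶠ x in cofinite, σ (a₀ ^ k) x = (a ^ k) x := by
          obtain ⟨n, rfl | rfl⟩ := k.eq_nat_or_neg
          · simpa using hσ.eventually_pow_eq ha n
          · simpa using hσ.eventually_pow_eq (hσ.eventually_inv_eq ha) n
        filter_upwards [(hF₀.isRay g).inv.tendsto.eventually hz] with n hn
        rw [hn, ← Equiv.Perm.mul_apply, ← Equiv.Perm.mul_apply]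
        congr 1
        exact ((Commute.refl a).inv_right.pow_right n).zpow_left k)
  have hφ : ∀ g : G, φ (g : G ⧸ Subgroup.zpowers a₀) = twoSidedClass σ a (F₀ g) := fun _ => rfl
  obtain ⟨q₁, hq₁⟩ := eventually_eq_of_near_invariant (b := (b : G ⧸ Subgroup.zpowers a₀))
    (c := (c : G ⧸ Subgroup.zpowers a₀)) (fun i j hij => by
      rw [← QuotientGroup.mk_zpow, ← QuotientGroup.mk_zpow, ← QuotientGroup.mk_mul,
        QuotientGroup.eq_one_iff] at hij
      obtain ⟨k, hk⟩ := Subgroup.mem_zpowers_iff.1 hij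
      exact (hind (-k) i j (by rw [mul_assoc, ← hk, zpow_neg, inv_mul_cancel])).2) φ (by
      intro s
      obtain ⟨s, rfl⟩ := QuotientGroup.mk_surjective s
      filter_upwards [hF₀.eventually_rayRel ha s] with q hq
      obtain ⟨g, rfl⟩ := QuotientGroup.mk_surjective q
      rw [← QuotientGroup.mk_mul, hφ, hφ]
      obtain ⟨-, h1, h2⟩ := hq g rfl
      exact hσ.twoSidedClass_eq (hF₀.isRay g) h1 h2)
  obtain ⟨g₁, rfl⟩ := QuotientGroup.mk_surjective q₁
  have hy := hF₀.isRay g₁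
  obtain ⟨F, hF⟩ := hσ.exists_isRayMap (hσ.eventually_commute ha) hy
  obtain ⟨F', hF'⟩ := hσ.exists_isRayMap
    (hσ.eventually_commute (hσ.eventually_inv_eq ha)) hy.inv
  refine ⟨F₀ g₁, F, F', hF, hF', ?_⟩
  have ht : Tendsto (fun q : G ⧸ Subgroup.zpowers a₀ => q * (g₁ : G ⧸ Subgroup.zpowers a₀))
      cofinite cofinite := (mul_left_injective _).tendsto_cofinite
  filter_upwards [ht.eventually hq₁] with q hq g hgq
  subst hgq
  have hFg : F g = F₀ (g * g₁) := (hF.rel g).unique (hF₀.rayRel g g₁)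
  rw [← QuotientGroup.mk_mul, hφ, hφ] at hq
  have hmem : F₀ g₁ ∈ twoSidedClass σ a (F₀ (g * g₁)) := by
    rw [hq]
    exact ⟨1, hσ.rayRel_one hy, hσ.rayRel_one hy.inv⟩
  obtain ⟨h, h1, h2⟩ := hmem
  rw [← hFg] at h1 h2
  have hh : g = h⁻¹ := hσ.eq_of_rayRel hy (hF.rel g) (hσ.rayRel_inv (hF.isRay g) h1)
  have hr : IsRay a⁻¹ (F g) := (hF.isRay g).inv
  have h3 := hσ.rayRel_inv hr h2
  rw [← hh] at h3
  exact h3.unique (hF'.rel g)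

theorem exists_zpow_height (ha₀ : ∀ k : ℤ, a₀ ^ k = 1 → k = 0) :
    ∃ κ : G → ℤ, ∀ (n : ℤ) (g : G), κ (a₀ ^ n * g) = n + κ g := by
  have h : ∀ g : G, ∃ k : ℤ, g = a₀ ^ k * (g : G ⧸ Subgroup.zpowers a₀).out := by
    intro g
    have hout : ((g : G ⧸ Subgroup.zpowers a₀).out : G ⧸ Subgroup.zpowers a₀) = g :=
      Quotient.out_eq _
    obtain ⟨k, hk⟩ := Subgroup.mem_zpowers_iff.1 (QuotientGroup.eq.1 hout)
    exact ⟨k, by rw [hk, mul_comm, mul_inv_cancel_left]⟩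
  choose κ hκ using h
  refine ⟨κ, fun n g => ?_⟩
  have hq : ((a₀ ^ n * g : G) : G ⧸ Subgroup.zpowers a₀) = g :=
    QuotientGroup.eq.2 (Subgroup.mem_zpowers_iff.2 ⟨-n, by
      rw [mul_inv_rev, mul_comm, ← mul_assoc, mul_inv_cancel, one_mul, zpow_neg]⟩)
  have h1 := hκ (a₀ ^ n * g)
  rw [hq] at h1
  have h2 := hκ g
  have h3 : a₀ ^ (κ (a₀ ^ n * g)) = a₀ ^ (n + κ g) := by
    refine mul_right_cancel (b := (g : G ⧸ Subgroup.zpowers a₀).out) ?_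
    rw [← h1, zpow_add, mul_assoc, ← h2]
  have := ha₀ (κ (a₀ ^ n * g) - (n + κ g)) (by rw [zpow_sub, h3, mul_inv_cancel])
  omega

/-- A near free, one-ended family of maps admits a near injective, near equivariant map from `G`,
provided `a₀` is near represented by a permutation. -/
theorem IsNearFreeFamily.exists_near_equivariant [Infinite X] (hσ : IsNearFreeFamily σ)
    (h1 : ∀ A : Set X, (∀ g, ∀ᶠ x in cofinite, x ∈ A → σ g x ∈ A) → A.Finite ∨ Aᶜ.Finite)
    (ha : ∀ᶠ x in cofinite, σ a₀ x = a x) {b c : G}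
    (hind : ∀ i j k : ℤ, a₀ ^ i * b ^ j * c ^ k = 1 → i = 0 ∧ j = 0 ∧ k = 0) :
    ∃ F : G → X, (∃ E : Set G, E.Finite ∧ Set.InjOn F Eᶜ) ∧
      ∀ s, ∀ᶠ g in cofinite, F (s * g) = σ s (F g) := by
  have ha₀ : ∀ k : ℤ, a₀ ^ k = 1 → k = 0 := fun k hk => (hind k 0 0 (by simpa using hk)).1
  obtain ⟨x₀, hx₀⟩ := hσ.exists_isRay h1 ha fun n hn h => hn (by
    have := ha₀ n (by simpa using h)
    omega)
  obtain ⟨y, F, F', hF, hF', hΛ⟩ := hσ.exists_isRayMap_pair ha hind hx₀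
  obtain ⟨κ, hκ⟩ := exists_zpow_height ha₀
  have hκn : ∀ (n : ℕ) g, κ (a₀ ^ n * g) = n + κ g := fun n g => by simpa using hκ n g
  have hκn' : ∀ (n : ℕ) g, κ (a₀⁻¹ ^ n * g) = -n + κ g := fun n g => by simpa using hκ (-n) g
  have ha' := hσ.eventually_inv_eq ha
  have hFp : ∀ g (n : ℕ), F (a₀ ^ n * g) = (a ^ n) (F g) :=
    hF.map_pow_mul (Commute.refl a) ha
  have hFn : ∀ g (n : ℕ), F' (a₀⁻¹ ^ n * g) = (a⁻¹ ^ n) (F' g) :=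
    hF'.map_pow_mul (Commute.refl a⁻¹) ha'
  have hFz : ∀ g (k : ℤ), F' (a₀ ^ k * g) = (a ^ k) (F' g) := fun g k => by
    have hm : F' (a₀⁻¹ ^ (-k) * g) = (a⁻¹ ^ (-k)) (F' g) := hF'.map_zpow_mul ha' g (-k)
    simpa using hm
  set H : G → X := fun g => if 0 ≤ κ g then F g else F' g with hH
  have hHpos : ∀ g, 0 ≤ κ g → H g = F g := fun g hg => if_pos hg
  have hHneg : ∀ g, κ g < 0 → H g = F' g := fun g hg => if_neg (not_le.2 hg)
  have hHeq : ∀ g, F g = F' g → H g = F g := fun g hg => by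
    simp only [hH]; split_ifs
    · rfl
    · exact hg.symm
  have hev : ∀ g, ∀ᶠ n : ℕ in atTop, 0 ≤ κ (a₀ ^ n * g) := fun g => by
    filter_upwards [eventually_ge_atTop (κ g).natAbs] with n hn
    rw [hκn]; omega
  have hev' : ∀ g, ∀ᶠ n : ℕ in atTop, κ (a₀⁻¹ ^ n * g) < 0 := fun g => by
    filter_upwards [eventually_gt_atTop (κ g).natAbs] with n hn
    rw [hκn']; omega
  refine ⟨H, ?_, fun s => ?_⟩
  · have hP : ∀ᶠ g in cofinite, 0 ≤ κ g → ∀ h, κ h < 0 → F g = F' h → g = h := by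
      refine eventually_cofinite_of_zpowers (a := a₀) ?_ (fun g => ?_) fun g => ?_
      · filter_upwards [hΛ] with q hq g hg _ h _ hgh
        exact hF'.injective ((hq g hg).symm.trans hgh)
      · have hΛ' : ∀ᶠ n : ℕ in atTop, ∀ q ∈ {q : G ⧸ Subgroup.zpowers a₀ | ¬ ∀ g : G,
            (g : G ⧸ Subgroup.zpowers a₀) = q → F g = F' g}, ∀ h : G,
            (h : G ⧸ Subgroup.zpowers a₀) = q → κ h < 0 → F (a₀ ^ n * g) ≠ F' h := by
          refine (eventually_all_finite hΛ).2 fun q _ => ?_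
          by_contra hno
          obtain ⟨n, hn, h, rfl, hh, e⟩ : ∃ n : ℕ, True ∧ ∃ h : G,
              (h : G ⧸ Subgroup.zpowers a₀) = q ∧ κ h < 0 ∧ F (a₀ ^ n * g) = F' h := by
            by_contra! hc
            exact hno (Eventually.of_forall fun n h e e' => hc n trivial h e e')
          refine hno ?_
          filter_upwards [eventually_gt_atTop (n + (κ h).natAbs)] with m hm h' hq hh' e'
          obtain ⟨k, hk⟩ := Subgroup.mem_zpowers_iff.1 (QuotientGroup.eq.1 hq)
          have hhk : h = a₀ ^ k * h' := by rw [hk, mul_comm, mul_inv_cancel_left]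
          have e1 : F (a₀ ^ n * g) = F (a₀ ^ k * (a₀ ^ m * g)) := by
            rw [e, hhk, hFz, ← e', hF.map_zpow_mul ha]
          have e2 := hκn n g
          rw [hF.injective e1, hκ, hκn] at e2
          rw [hhk, hκ] at hm hh
          omega
        filter_upwards [hΛ'] with n hn _ h hh e
        by_cases hq : F h = F' h
        · exact hF.injective (e.trans hq.symm)
        · exact (hn h (fun hc => hq (hc h rfl)) h rfl hh e).elim
      · filter_upwards [hev' g] with n hn hn'
        exact (not_le.2 hn hn').elim
    refine ⟨_, hP, fun g hg h hh e => ?_⟩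
    rw [compl_compl] at hg hh
    rcases le_or_gt 0 (κ g) with h1 | h1 <;> rcases le_or_gt 0 (κ h) with h2 | h2
    · rw [hHpos g h1, hHpos h h2] at e
      exact hF.injective e
    · rw [hHpos g h1, hHneg h h2] at e
      exact hg h1 h h2 e
    · rw [hHneg g h1, hHpos h h2] at e
      exact (hh h2 g h1 e.symm).symm
    · rw [hHneg g h1, hHneg h h2] at e
      exact hF'.injective e
  · refine eventually_cofinite_of_zpowers (a := a₀) ?_ (fun g => ?_) fun g => ?_
    · have ht : Tendsto (fun q : G ⧸ Subgroup.zpowers a₀ => (s : G ⧸ Subgroup.zpowers a₀) * q)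
        cofinite cofinite := (mul_right_injective _).tendsto_cofinite
      filter_upwards [hΛ, ht.eventually hΛ, hF.eventually_rayRel ha s] with q e1 e2 e3 g hg
      rw [hHeq g (e1 g hg), hHeq (s * g) (e2 _ (by rw [← hg]; rfl)), (e3 g hg).1]
    · filter_upwards [hev g, hev (s * g), hF.rayRel s g] with n e1 e2 e3
      rw [mul_left_comm, hHpos _ e1, hHpos _ e2, hFp, hFp, e3]
    · filter_upwards [hev' g, hev' (s * g), hF'.rayRel s g] with n e1 e2 e3
      rw [mul_left_comm, hHneg _ e1, hHneg _ e2, hFn, hFn, e3]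

end Comparison

section Index

/-- The index of a map on a cofinite set. -/
noncomputable def indexOn (f : X → X) (U : Set X) : ℤ := (f '' U)ᶜ.ncard - Uᶜ.ncard

theorem indexOn_congr {f f' : X → X} {U : Set X} (h : Set.EqOn f f' U) :
    indexOn f U = indexOn f' U := by
  rw [indexOn, indexOn, h.image_eq]

theorem indexOn_comp (f f' : X → X) (U : Set X) :
    indexOn (f' ∘ f) U = indexOn f' (f '' U) + indexOn f U := by
  rw [indexOn, indexOn, indexOn, Set.image_comp]
  ring

theorem indexOn_mono {f : X → X} {U V : Set X} (hf : Set.InjOn f V) (hUV : U ⊆ V)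
    (hU : Uᶜ.Finite) (hV : (f '' V)ᶜ.Finite) : indexOn f U = indexOn f V := by
  have hd : (V \ U).Finite := hU.subset fun x hx => hx.2
  have e1 : Uᶜ = Vᶜ ∪ V \ U := by
    ext x; have := @hUV x; simp only [Set.mem_compl_iff, Set.mem_union, Set.mem_sdiff]; tauto
  have e2 : (f '' U)ᶜ = (f '' V)ᶜ ∪ f '' (V \ U) := by
    rw [hf.image_sdiff_subset hUV]
    have := Set.image_mono (f := f) hUV
    ext x; have := @this x
    simp only [Set.mem_compl_iff, Set.mem_union, Set.mem_sdiff]; tauto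
  have d1 : Disjoint Vᶜ (V \ U) := Set.disjoint_left.2 fun x h h' => h h'.1
  have d2 : Disjoint (f '' V)ᶜ (f '' (V \ U)) :=
    Set.disjoint_left.2 fun x h h' => h (Set.image_mono Set.sdiff_subset h')
  rw [indexOn, indexOn, e1, e2, Set.ncard_union_eq d1 (hU.subset (Set.compl_subset_compl.2 hUV)) hd,
    Set.ncard_union_eq d2 hV (hd.image f), Set.InjOn.ncard_image (hf.mono Set.sdiff_subset)]
  push_cast
  ring

theorem IsCofinBij.indexOn_eq {e : PartialEquiv X X} (he : IsCofinBij e) {U : Set X}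
    (hU : Uᶜ.Finite) (h : U ⊆ e.source) : indexOn e U = indexOn e e.source :=
  indexOn_mono e.injOn h hU (by rw [e.image_source_eq_target]; exact he.2)

theorem IsCofinBij.indexOn_congr {e e' : PartialEquiv X X} (he : IsCofinBij e)
    (he' : IsCofinBij e') (h : NearEqv e e') : indexOn e e.source = indexOn e' e'.source := by
  rw [← he.indexOn_eq h fun x hx => hx.1, ← he'.indexOn_eq h fun x hx => hx.2.1]
  exact _root_.indexOn_congr fun x hx => hx.2.2

/-- The index homomorphism of the near symmetric group. -/
noncomputable def nearIndex (X : Type u) : NearPerm X →* Multiplicative ℤ where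
  toFun f := Quotient.liftOn f (fun e => Multiplicative.ofAdd (indexOn e.1 e.1.source))
    fun a b h => congrArg _ (a.2.indexOn_congr b.2 h)
  map_one' := by
    change Multiplicative.ofAdd (indexOn (PartialEquiv.refl X) (PartialEquiv.refl X).source) = 1
    simp [indexOn]
  map_mul' f g := by
    refine Quotient.inductionOn₂ f g fun a b => ?_
    change Multiplicative.ofAdd (indexOn (b.1.trans a.1) (b.1.trans a.1).source) =
      Multiplicative.ofAdd (indexOn a.1 a.1.source) * Multiplicative.ofAdd (indexOn b.1 b.1.source)
    have hs := (b.2.trans a.2).1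
    have hsub : (b.1.trans a.1).source ⊆ b.1.source := by
      rw [PartialEquiv.trans_source]; exact Set.inter_subset_left
    have himg : (b.1 '' (b.1.trans a.1).source)ᶜ.Finite := by
      rw [PartialEquiv.image_trans_source]
      rw [Set.compl_inter]
      exact b.2.2.union a.2.1
    rw [← ofAdd_add, PartialEquiv.coe_trans, indexOn_comp, b.2.indexOn_eq hs hsub,
      a.2.indexOn_eq himg (by
        rw [PartialEquiv.image_trans_source]; exact Set.inter_subset_right)]

theorem exists_perm_of_index_eq_zero {e : PartialEquiv X X} (he : IsCofinBij e)
    (h : indexOn e e.source = 0) : ∃ a : Equiv.Perm X, ∀ x ∈ e.source, a x = e x := by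
  classical
  have hcard : e.sourceᶜ.ncard = e.targetᶜ.ncard := by
    rw [indexOn, e.image_source_eq_target] at h
    omega
  have := he.1.to_subtype
  have := he.2.to_subtype
  let f : (e.sourceᶜ : Set X) ≃ (e.targetᶜ : Set X) :=
    Classical.choice (Finite.card_eq.1 (by simpa only [Nat.card_coe_set_eq] using hcard))
  refine ⟨Equiv.subtypeCongr e.toEquiv f, fun x hx => ?_⟩
  rw [Equiv.subtypeCongr]
  simp [Equiv.sumCompl_symm_apply_of_pos hx]
  rfl

end Index

section Representatives

variable {G : Type w} [CommGroup G] (α : G →* NearPerm X)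

/-- A choice of representatives of a near action, as maps `X → X`. -/
noncomputable def nearRep (g : G) : PartialEquiv X X := (Quotient.out (α g)).1

theorem isCofinBij_nearRep (g : G) : IsCofinBij (nearRep α g) := (Quotient.out (α g)).2

theorem mk_nearRep (g : G) : NearPerm.mk (nearRep α g) (isCofinBij_nearRep α g) = α g :=
  Quotient.out_eq (α g)

theorem IsCofinBij.tendsto {e : PartialEquiv X X} (he : IsCofinBij e) :
    Tendsto e cofinite cofinite := by
  refine le_cofinite_iff_eventually_ne.2 fun y => ?_
  change {x | ¬ e x ≠ y}.Finite
  refine (he.1.union (Set.finite_singleton (e.symm y))).subset fun x hx => ?_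
  simp only [Set.mem_ofPred_eq, ne_eq, not_not] at hx
  by_cases hs : x ∈ e.source
  · exact Or.inr (by rw [Set.mem_singleton_iff, ← hx, e.left_inv hs])
  · exact Or.inl hs

theorem eventually_eq_of_mk_eq {e e' : PartialEquiv X X} {he : IsCofinBij e} {he' : IsCofinBij e'}
    (h : NearPerm.mk e he = NearPerm.mk e' he') :
    ∀ᶠ x in cofinite, x ∈ e.source ∧ x ∈ e'.source ∧ e x = e' x :=
  Quotient.exact h

theorem eventually_eq_nearRep {g : G} {e : PartialEquiv X X} {he : IsCofinBij e}
    (h : NearPerm.mk e he = α g) : ∀ᶠ x in cofinite, x ∈ e.source ∧ e x = nearRep α g x :=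
  (eventually_eq_of_mk_eq (h.trans (mk_nearRep α g).symm)).mono fun _ hx => ⟨hx.1, hx.2.2⟩

theorem isNearFreeFamily_nearRep (hfree : ∀ g : G, g ≠ 1 → ∀ (e : PartialEquiv X X)
      (he : IsCofinBij e), NearPerm.mk e he = α g → {x : X | x ∈ e.source ∧ e x = x}.Finite) :
    IsNearFreeFamily fun g => ⇑(nearRep α g) where
  one := (eventually_eq_nearRep α (g := 1) (he := isCofinBij_refl)
    (by rw [map_one]; rfl)).mono fun x hx => hx.2.symm
  mul g h := (eventually_eq_nearRep α (g := g * h)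
    (he := (isCofinBij_nearRep α h).trans (isCofinBij_nearRep α g))
    (by rw [map_mul, ← mk_nearRep α g, ← mk_nearRep α h]; rfl)).mono fun x hx => hx.2.symm
  tendsto g := (isCofinBij_nearRep α g).tendsto
  free g hg := by
    have h1 : ∀ᶠ x in cofinite, ¬ (x ∈ (nearRep α g).source ∧ nearRep α g x = x) :=
      (hfree g hg _ _ (mk_nearRep α g)).compl_mem_cofinite
    have h2 : ∀ᶠ x in cofinite, x ∈ (nearRep α g).source :=
      (isCofinBij_nearRep α g).1
    filter_upwards [h1, h2] with x e1 e2 e3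
    exact e1 ⟨e2, e3⟩

theorem commensurated_of_eventually {A : Set X}
    (hA : ∀ g, ∀ᶠ x in cofinite, x ∈ A → nearRep α g x ∈ A) : Commensurated α A := by
  have key : ∀ (g : G) (e : PartialEquiv X X) (he : IsCofinBij e), NearPerm.mk e he = α g →
      {x | ¬ (x ∈ A → e x ∈ A)}.Finite := fun g e he h => by
    have : ∀ᶠ x in cofinite, x ∈ A → e x ∈ A := by
      filter_upwards [hA g, eventually_eq_nearRep α h] with x h1 h2
      rwa [h2.2]
    exact this
  intro g e he h
  have h' : NearPerm.mk e.symm he.symm = α g⁻¹ := by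
    rw [map_inv, ← h]; rfl
  refine (((key g e he h).image e).union (he.2.union (key g⁻¹ _ _ h'))).subset ?_
  rintro y (⟨⟨x, ⟨hx, hs⟩, rfl⟩, hy⟩ | ⟨hy, hy'⟩)
  · exact Or.inl ⟨x, fun h => hy (h hx), rfl⟩
  · by_cases ht : y ∈ e.target
    · refine Or.inr (Or.inr fun h => hy' ⟨e.symm y, ⟨h hy, e.map_target ht⟩, e.right_inv ht⟩)
    · exact Or.inr (Or.inl ht)

/-- Some element of a rank three subgroup, independent of two others, is near represented by a
permutation. -/
theorem exists_eventually_perm {u : Fin 3 → G}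
    (hu : ∀ i j k : ℤ, u 0 ^ i * u 1 ^ j * u 2 ^ k = 1 → i = 0 ∧ j = 0 ∧ k = 0) :
    ∃ (a₀ b c : G) (a : Equiv.Perm X), (∀ᶠ x in cofinite, nearRep α a₀ x = a x) ∧
      ∀ i j k : ℤ, a₀ ^ i * b ^ j * c ^ k = 1 → i = 0 ∧ j = 0 ∧ k = 0 := by
  have hperm : ∀ g, nearIndex X (α g) = 1 →
      ∃ a : Equiv.Perm X, ∀ᶠ x in cofinite, nearRep α g x = a x := by
    intro g hg
    rw [← mk_nearRep α g] at hg
    obtain ⟨a, ha⟩ := exists_perm_of_index_eq_zero (isCofinBij_nearRep α g)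
      (Multiplicative.ofAdd.injective hg)
    have h2 : ∀ᶠ x in cofinite, x ∈ (nearRep α g).source :=
      (isCofinBij_nearRep α g).1
    exact ⟨a, h2.mono fun x hx => (ha x hx).symm⟩
  set k := (nearIndex X (α (u 0))).toAdd with hk
  set l := (nearIndex X (α (u 1))).toAdd with hl
  by_cases hk0 : k = 0
  · obtain ⟨a, ha⟩ := hperm (u 0) (Multiplicative.toAdd.injective hk0)
    exact ⟨u 0, u 1, u 2, a, ha, hu⟩
  · obtain ⟨a, ha⟩ := hperm (u 0 ^ l * u 1 ^ (-k)) (Multiplicative.toAdd.injective (by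
      rw [map_mul, map_mul, map_zpow, map_zpow, map_zpow, map_zpow, toAdd_mul, toAdd_zpow,
        toAdd_zpow, ← hk, ← hl, toAdd_one, smul_eq_mul, smul_eq_mul]
      ring))
    refine ⟨_, u 0, u 2, a, ha, fun x y z h => ?_⟩
    obtain ⟨h1, h2, h3⟩ := hu (l * x + y) (-k * x) z (by
      rw [← h, mul_zpow, ← zpow_mul, ← zpow_mul, zpow_add]
      congr 1
      exact mul_right_comm _ _ _)
    have hx : x = 0 := by
      rcases mul_eq_zero.1 h2 with h | h
      · exact absurd (neg_eq_zero.1 h) hk0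
      · exact h
    subst hx
    exact ⟨rfl, by simpa using h1, h3⟩

end Representatives

theorem exists_independent_of_mulEquiv {G F : Type*} [CommGroup G] [CommGroup F] {d : ℕ}
    (hd : 3 ≤ d) (φ : G ≃* Multiplicative (Fin d → ℤ) × F) :
    ∃ u : Fin 3 → G, ∀ i j k : ℤ, u 0 ^ i * u 1 ^ j * u 2 ^ k = 1 → i = 0 ∧ j = 0 ∧ k = 0 := by
  let t : Fin 3 → Fin d := Fin.castLE hd
  refine ⟨fun m => φ.symm (Multiplicative.ofAdd (Pi.single (t m) 1), 1), fun i j k h => ?_⟩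
  have h' := congrArg (fun g => (φ g).1.toAdd) h
  simp only [map_mul, map_zpow, MulEquiv.apply_symm_apply, map_one, Prod.fst_mul, Prod.pow_fst,
    toAdd_mul, toAdd_zpow, toAdd_ofAdd, Prod.fst_one, toAdd_one] at h'
  have h0 := congrFun h' (t 0)
  have h1 := congrFun h' (t 1)
  have h2 := congrFun h' (t 2)
  simp [t, Fin.ext_iff] at h0 h1 h2
  exact ⟨h0, h1, h2⟩

/-- Let `G` be a finitely generated abelian group of ℚ-rank at least `3` (i.e.
`G ≅ ℤ^d × F` with `d ≥ 3` and `F` finite).  Every near free, 1-ended near `G`-set `X`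
is near isomorphic to the simply transitive action of `G` on itself: there are cofinite
subsets `X' ⊆ X`, `G' ⊆ G` and a bijection `f : X' ≃ G'` which is near equivariant, in
the sense that for every `g` and every representative `e` of `α g`, for all but finitely
many `x ∈ X'` one has `e x ∈ X'` and `f (e x) = g * f x`. -/
theorem rank_ge_three_near_free_one_ended_near_action_near_simply_transitive
    {G : Type w} [CommGroup G] [Group.FG G]
    (hrank : ∃ d : ℕ, 3 ≤ d ∧ ∃ F : Subgroup G, Finite F ∧
      Nonempty (G ≃* (Multiplicative (Fin d → ℤ) × F)))
    {X : Type u} (α : G →* NearPerm X)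
    (hfree : ∀ g : G, g ≠ 1 → ∀ (e : PartialEquiv X X) (he : IsCofinBij e),
      NearPerm.mk e he = α g → {x : X | x ∈ e.source ∧ e x = x}.Finite)
    (hXinf : Infinite X)
    (h1end : ∀ A : Set X, Commensurated α A → A.Finite ∨ Aᶜ.Finite) :
    ∃ (X' : Set X) (G' : Set G), X'ᶜ.Finite ∧ G'ᶜ.Finite ∧
      ∃ f : X' ≃ G',
        ∀ (g : G) (e : PartialEquiv X X) (he : IsCofinBij e), NearPerm.mk e he = α g →
          {x : X' | ¬ ∃ (_ : (x : X) ∈ e.source) (hy : e (x : X) ∈ X'),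
              ((f ⟨e (x : X), hy⟩ : G) = g * (f x : G))}.Finite := by
  obtain ⟨d, hd, K, -, ⟨φ⟩⟩ := hrank
  obtain ⟨u, hu⟩ := exists_independent_of_mulEquiv hd φ
  obtain ⟨a₀, b, c, a, ha, hind⟩ := exists_eventually_perm α hu
  have hσ := isNearFreeFamily_nearRep α hfree
  have h1 : ∀ A : Set X, (∀ g, ∀ᶠ x in cofinite, x ∈ A → nearRep α g x ∈ A) →
      A.Finite ∨ Aᶜ.Finite := fun A hA => h1end A (commensurated_of_eventually α hA)
  obtain ⟨F, ⟨E, hE, hinj⟩, hF⟩ := hσ.exists_near_equivariant h1 ha hind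
  have : Infinite G := Infinite.of_injective (fun n : ℤ => a₀ ^ n) fun n m h => by
    have := (hind (n - m) 0 0 (by simpa [zpow_sub, mul_inv_eq_one] using h)).1
    omega
  have hrange : (Set.range F)ᶜ.Finite := by
    refine (h1 _ fun s => ?_).resolve_left fun hfin => ?_
    · refine Set.Finite.subset (Set.Finite.image F (hF s)) fun x hx => ?_
      simp only [Set.mem_compl_iff, Set.mem_ofPred_eq, Classical.not_imp] at hx
      obtain ⟨⟨g, rfl⟩, hg⟩ := hx
      exact ⟨g, fun h => hg ⟨s * g, h⟩, rfl⟩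
    · exact hE.infinite_compl
        (Set.Finite.of_finite_image (hfin.subset (Set.image_subset_range F _)) hinj)
  have hX' : (F '' Eᶜ)ᶜ.Finite := by
    refine (hrange.union (hE.image F)).subset fun x hx => ?_
    by_cases hr : x ∈ Set.range F
    · obtain ⟨g, rfl⟩ := hr
      by_cases hg : g ∈ E
      · exact Or.inr ⟨g, hg, rfl⟩
      · exact (hx ⟨g, hg, rfl⟩).elim
    · exact Or.inl hr
  let f : (Eᶜ : Set G) ≃ (F '' Eᶜ : Set X) := hinj.bijOn_image.equiv F
  have hf : ∀ g : (Eᶜ : Set G), (f g : X) = F g := fun _ => rfl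
  refine ⟨F '' Eᶜ, Eᶜ, hX', by rwa [compl_compl], f.symm, fun s e he hes => ?_⟩
  have h2 : ∀ᶠ g in cofinite, s * g ∉ E :=
    (mul_right_injective s).tendsto_cofinite.eventually hE.compl_mem_cofinite
  have h3 := eventually_eq_nearRep α hes
  refine Set.Finite.of_finite_image ?_ Subtype.val_injective.injOn
  refine (Set.Finite.union h3 (Set.Finite.image F (Set.Finite.union (hF s) h2))).subset ?_
  rintro _ ⟨x, hx, rfl⟩
  obtain ⟨g, rfl⟩ := f.surjective x
  by_contra hc
  rw [Set.mem_union, not_or] at hc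
  obtain ⟨hc1, hc2⟩ := hc
  simp only [Set.mem_compl_iff, Set.mem_ofPred_eq, not_not] at hc1
  have hc3 : F (s * g) = nearRep α s (F g) ∧ s * g ∉ E := by
    by_contra hn
    refine hc2 ⟨g, ?_, rfl⟩
    by_cases h : F (s * g) = nearRep α s (F g)
    · exact Or.inr fun h' => hn ⟨h, h'⟩
    · exact Or.inl h
  have he' : e (f g) = F (s * g) := hc1.2.trans hc3.1.symm
  refine hx ⟨hc1.1, by rw [he']; exact ⟨_, hc3.2, rfl⟩, ?_⟩
  have : (⟨e (f g), by rw [he']; exact ⟨_, hc3.2, rfl⟩⟩ : (F '' Eᶜ : Set X)) =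
      f ⟨s * g, hc3.2⟩ := Subtype.ext he'
  rw [this, Equiv.symm_apply_apply, Equiv.symm_apply_apply]
end
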